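/- There exist a smooth function σ : [−1,1] → ℝ, positive on (−1,1), even about r = 0 and satisfying σ(r) = (r+1)² for r ∈ [−1,−7/8], together with three pairwise distinct functions l₋, l₊, l₀ : [−1,1] → ℝ, such that: each of l₋, l₊, l₀ is the restriction of a smooth function on (−3,3) that is even about r = −1 and even about r = 1; each solves l'' = (l³ − l)/σ on (−1,1) with l(−1) = −1 and l(1) = 1; each has l' > 0 on (−1,1), l''(−1) > 0 and l''(1) < 0; the function l₀ is odd about r = 0 (l₀(−r) = −l₀(r)), while neither l₋ nor l₊ is odd about r = 0. -/

import Mathlib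

namespace XC

/-- Coefficients of the regular singular solution. -/
noncomputable def dc : ℕ → ℝ
  | 0 => 1
  | (n+1) => (-3 * (∑ i : Fin (n+1), dc i * dc (n - i)) +
      ∑ i : Fin n, ∑ j : Fin (n - i), dc i * (dc j * dc (n - 1 - i - j))) /
        (2 * (n+1) * (2*n+5))
  termination_by n => n
  decreasing_by all_goals omega

noncomputable def Qc (n : ℕ) : ℝ := ∑ ij ∈ Finset.HasAntidiagonal.antidiagonal n, dc ij.1 * dc ij.2
noncomputable def Tc (n : ℕ) : ℝ := ∑ ij ∈ Finset.HasAntidiagonal.antidiagonal n, dc ij.1 * Qc ij.2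

lemma dc_zero : dc 0 = 1 := by rw [dc]

lemma dc_succ (n : ℕ) : (2 * (n+1) * (2*n+5)) * dc (n+1) =
    -3 * Qc n + (if n = 0 then 0 else Tc (n-1)) := by
  have h : (2 * ((n:ℝ)+1) * (2*n+5)) ≠ 0 := by positivity
  rw [dc, mul_div_cancel₀ _ h]
  congr 1
  · rw [Qc, Finset.Nat.sum_antidiagonal_eq_sum_range_succ_mk, ← Fin.sum_univ_eq_sum_range (fun i => dc i * dc (n-i))]
  · split_ifs with h0
    · subst h0; simp
    · obtain ⟨m, rfl⟩ := Nat.exists_eq_succ_of_ne_zero h0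
      simp only [Nat.succ_eq_add_one, Nat.add_sub_cancel]
      rw [Tc, Finset.Nat.sum_antidiagonal_eq_sum_range_succ_mk, ← Fin.sum_univ_eq_sum_range (fun i => dc i * Qc (m-i))]
      refine Finset.sum_congr rfl fun i _ => ?_
      rw [Qc, Finset.Nat.sum_antidiagonal_eq_sum_range_succ_mk, Finset.mul_sum]
      have : m + 1 - (i:ℕ) = (m - i) + 1 := by omega
      rw [this, Fin.sum_univ_eq_sum_range (fun j => dc i * (dc j * dc (m - i - j)))]

lemma Qc_bound (n : ℕ) (h : ∀ k ≤ n, |dc k| ≤ (1/2)^k) : |Qc n| ≤ (n+1) * (1/2)^n := by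
  rw [Qc]
  refine (Finset.abs_sum_le_sum_abs _ _).trans ?_
  have : ∀ ij ∈ Finset.HasAntidiagonal.antidiagonal n, |dc ij.1 * dc ij.2| ≤ (1/2:ℝ)^n := by
    intro ij hij
    rw [Finset.HasAntidiagonal.mem_antidiagonal] at hij
    rw [abs_mul, ← hij, pow_add]
    exact mul_le_mul (h _ (by omega)) (h _ (by omega)) (abs_nonneg _) (by positivity)
  refine (Finset.sum_le_sum this).trans ?_
  simp

lemma Tc_bound (n : ℕ) (h : ∀ k ≤ n, |dc k| ≤ (1/2)^k) : |Tc n| ≤ (n+1)^2 * (1/2)^n := by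
  rw [Tc]
  refine (Finset.abs_sum_le_sum_abs _ _).trans ?_
  have : ∀ ij ∈ Finset.HasAntidiagonal.antidiagonal n, |dc ij.1 * Qc ij.2| ≤ (n+1) * (1/2:ℝ)^n := by
    intro ij hij
    rw [Finset.HasAntidiagonal.mem_antidiagonal] at hij
    rw [abs_mul]
    have h1 := h ij.1 (by omega)
    have h2 := Qc_bound ij.2 (fun k hk => h k (by omega))
    have h3 : ((ij.2:ℕ):ℝ) ≤ n := by exact_mod_cast (by omega : ij.2 ≤ n)
    calc |dc ij.1| * |Qc ij.2| ≤ (1/2)^ij.1 * ((ij.2+1) * (1/2)^ij.2) :=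
          mul_le_mul h1 h2 (abs_nonneg _) (by positivity)
      _ = (ij.2+1) * (1/2)^n := by rw [← hij, pow_add]; ring
      _ ≤ _ := by gcongr
  refine (Finset.sum_le_sum this).trans ?_
  simp; apply le_of_eq; ring

lemma dc_bound (n : ℕ) : |dc n| ≤ (1/2)^n := by
  induction n using Nat.strong_induction_on with
  | _ n ih =>
    rcases n with _ | n
    · simp [dc_zero]
    · have h := dc_succ n
      have hp : (0:ℝ) < (2 * (n+1) * (2*n+5)) := by positivity
      have hQ := Qc_bound n (fun k hk => ih k (by omega))
      have hT : |if n = 0 then 0 else Tc (n-1)| ≤ 2 * n^2 * (1/2)^n := by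
        split_ifs with h0
        · simp [h0]
        · obtain ⟨m, rfl⟩ := Nat.exists_eq_succ_of_ne_zero h0
          have := Tc_bound m (fun k hk => ih k (by omega))
          simp only [Nat.succ_eq_add_one, Nat.add_sub_cancel]
          refine this.trans (le_of_eq ?_)
          push_cast; rw [pow_succ]; ring
      have h2 : (2 * (n+1) * (2*n+5)) * |dc (n+1)| ≤ (3 * (n+1) + 2*n^2) * (1/2)^n := by
        rw [← abs_of_pos hp, ← abs_mul, h]
        refine (abs_add_le _ _).trans ?_
        rw [abs_mul]
        norm_num
        norm_num at hQ hT
        nlinarith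
      have h3 : (3 * ((n:ℝ)+1) + 2*n^2) * (1/2)^n ≤ (2 * (n+1) * (2*n+5)) * (1/2)^(n+1) := by
        rw [pow_succ (1/2:ℝ) n]
        have : (0:ℝ) < (1/2)^n := by positivity
        have hn : (0:ℝ) ≤ n := Nat.cast_nonneg n
        nlinarith [mul_nonneg hn this.le]
      exact le_of_mul_le_mul_left (h2.trans h3) hp

/-- coefficient classes -/
def Adm (a : ℕ → ℝ) : Prop := ∃ C : ℝ, ∃ m : ℕ, 0 ≤ C ∧ ∀ n, |a n| ≤ C * ((n:ℝ)+1)^m * (1/2)^n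

noncomputable def ps (a : ℕ → ℝ) (z : ℝ) : ℝ := ∑' n, a n * z^n
def shift (a : ℕ → ℝ) (n : ℕ) : ℝ := (n+1) * a (n+1)

lemma Adm.summable {a : ℕ → ℝ} (h : Adm a) {z : ℝ} (hz : |z| < 2) : Summable (fun n => |a n * z^n|) := by
  obtain ⟨C, m, hC, h⟩ := h
  have hr : ‖|z|/2‖ < 1 := by rw [Real.norm_eq_abs, abs_of_nonneg (by positivity)]; linarith
  have h1 := summable_pow_mul_geometric_of_norm_lt_one m hr
  have h2 : Summable (fun n : ℕ => C * ((n:ℝ)+1)^m * (|z|/2)^n) := by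
    have : ∀ n : ℕ, C * ((n:ℝ)+1)^m * (|z|/2)^n ≤ C * 2^m * ((n:ℝ)^m * (|z|/2)^n + (0:ℝ)^n) := by
      intro n
      rcases n with _ | n
      · simp; nlinarith [one_le_pow₀ (n := m) (by norm_num : (1:ℝ) ≤ 2), mul_nonneg hC (by positivity : (0:ℝ) ≤ 2^m * 0^m), mul_le_mul_of_nonneg_left (one_le_pow₀ (n := m) (by norm_num : (1:ℝ) ≤ 2)) hC]
      · have : (((n+1:ℕ):ℝ)+1)^m ≤ 2^m * ((n+1:ℕ):ℝ)^m := by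
          rw [← mul_pow]; gcongr; push_cast; linarith [Nat.cast_nonneg (α := ℝ) n]
        have h0 : (0:ℝ) ≤ (|z|/2)^(n+1) := by positivity
        have := mul_le_mul_of_nonneg_right (mul_le_mul_of_nonneg_left this hC) h0
        simp only [pow_succ (0:ℝ), mul_zero, add_zero]
        linarith
    refine Summable.of_nonneg_of_le (fun n => by positivity) this ?_
    apply Summable.mul_left
    apply h1.add
    exact summable_geometric_of_lt_one le_rfl (by norm_num)
  refine Summable.of_nonneg_of_le (fun n => abs_nonneg _) (fun n => ?_) h2
  rw [abs_mul, abs_pow, div_pow]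
  calc |a n| * |z|^n ≤ (C * ((n:ℝ)+1)^m * (1/2)^n) * |z|^n := by gcongr; exact h n
    _ = _ := by rw [div_pow, one_pow]; ring

lemma Adm.shift {a : ℕ → ℝ} (h : Adm a) : Adm (shift a) := by
  obtain ⟨C, m, hC, h⟩ := h
  refine ⟨C * 2^m, m+1, by positivity, fun n => ?_⟩
  rw [XC.shift, abs_mul, abs_of_nonneg (by positivity : (0:ℝ) ≤ (n:ℝ)+1)]
  calc ((n:ℝ)+1) * |a (n+1)| ≤ (n+1) * (C * (((n+1:ℕ):ℝ)+1)^m * (1/2)^(n+1)) := by gcongr; exact h _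
    _ ≤ (n+1) * (C * (2 * ((n:ℝ)+1))^m * (1/2)^n) := by
        gcongr ?_ * (C * ?_^m * ?_)
        · push_cast; linarith [Nat.cast_nonneg (α := ℝ) n]
        · rw [pow_succ]; linarith [show (0:ℝ) < (1/2)^n by positivity]
    _ = _ := by rw [mul_pow]; ring

lemma ps_deriv {a : ℕ → ℝ} (h : Adm a) {z : ℝ} (hz : |z| < 2) : HasDerivAt (ps a) (ps (shift a) z) z := by
  obtain ⟨ρ, h1, h2⟩ := exists_between hz
  have hρ : 0 < ρ := (abs_nonneg z).trans_lt h1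
  have hs := h.shift.summable (z := ρ) (by rw [abs_of_pos hρ]; exact h2)
  have hu : Summable (fun n : ℕ => |n * a n * ρ^(n-1)|) := by
    rw [← summable_nat_add_iff 1]
    refine hs.congr fun n => ?_
    simp [shift]
  have key := hasDerivAt_tsum_of_isPreconnected (g := fun n z => a n * z^n)
    (g' := fun n z => n * a n * z^(n-1)) (t := Set.Ioo (-ρ) ρ) hu isOpen_Ioo isPreconnected_Ioo
    (fun n y _ => by
      have := (hasDerivAt_pow n y).const_mul (a n)
      have e : (n:ℝ) * a n * y^(n-1) = a n * (n * y^(n-1)) := by ring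
      rw [e]; exact this)
    (fun n y hy => by
      rw [Real.norm_eq_abs, abs_mul, abs_mul _ (ρ^_), abs_pow, abs_pow, abs_of_pos hρ]
      gcongr
      exact (abs_lt.2 hy).le)
    (y₀ := 0) (y := z) (by constructor <;> linarith)
    (by exact (h.summable (z := 0) (by simp)).of_abs)
    (abs_lt.1 h1)
  have e : ps (shift a) z = ∑' n : ℕ, (n:ℝ) * a n * z^(n-1) := by
    have hsum : Summable (fun n : ℕ => (n:ℝ) * a n * z^(n-1)) := by
      rw [← summable_nat_add_iff 1]
      refine (h.shift.summable hz).of_abs.congr fun n => ?_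
      simp [shift]
    rw [hsum.tsum_eq_zero_add]
    simp [ps, shift]
  rw [e]; exact key

lemma ps_contDiffOn (n : ℕ) : ∀ {a : ℕ → ℝ}, Adm a → ContDiffOn ℝ n (ps a) (Set.Ioo (-2) 2) := by
  induction n with
  | zero =>
    intro a h
    simp only [Nat.cast_zero, contDiffOn_zero]
    exact fun z hz => (ps_deriv h (abs_lt.2 hz)).continuousAt.continuousWithinAt
  | succ n ih =>
    intro a h
    push_cast
    rw [contDiffOn_succ_iff_deriv_of_isOpen isOpen_Ioo]
    refine ⟨fun z hz => (ps_deriv h (abs_lt.2 hz)).differentiableAt.differentiableWithinAt, by simp, ?_⟩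
    exact (ih h.shift).congr fun z hz => (ps_deriv h (abs_lt.2 hz)).deriv

lemma dc_adm : Adm dc := ⟨1, 0, by norm_num, fun n => by simpa using dc_bound n⟩
lemma ps_mul {a b : ℕ → ℝ} (ha : Adm a) (hb : Adm b) {z : ℝ} (hz : |z| < 2) :
    ps a z * ps b z = ps (fun n => ∑ ij ∈ Finset.HasAntidiagonal.antidiagonal n, a ij.1 * b ij.2) z := by
  unfold ps
  have := tsum_mul_tsum_eq_tsum_sum_antidiagonal_of_summable_norm
    (f := fun n => a n * z^n) (g := fun n => b n * z^n) (ha.summable hz) (hb.summable hz)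
  rw [this]
  congr 1; ext n
  rw [Finset.sum_mul]
  refine Finset.sum_congr rfl fun ij h => ?_
  rw [Finset.HasAntidiagonal.mem_antidiagonal] at h
  rw [← h, pow_add]; ring

lemma Qc_adm : Adm Qc := ⟨1, 1, by norm_num, fun n => by simpa using Qc_bound n (fun k _ => dc_bound k)⟩
lemma Tc_adm : Adm Tc := ⟨1, 2, by norm_num, fun n => by simpa using Tc_bound n (fun k _ => dc_bound k)⟩

lemma D_ode {z : ℝ} (hz : |z| < 2) : 4 * z * ps (shift (shift dc)) z + 10 * ps (shift dc) z =
    -3 * ps dc z ^2 + z * ps dc z ^ 3 := by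
  have e2 : ps dc z ^ 2 = ps Qc z := by rw [sq, ps_mul dc_adm dc_adm hz]; rfl
  have e3 : ps dc z ^ 3 = ps Tc z := by
    rw [pow_succ', e2, ps_mul dc_adm Qc_adm hz]; rfl
  rw [e2, e3]
  have s1 := (dc_adm.shift.shift.summable hz).of_abs
  have s2 := (dc_adm.shift.summable hz).of_abs
  have s3 := (Qc_adm.summable hz).of_abs
  have s4 := (Tc_adm.summable hz).of_abs
  have t2 := s2.tsum_eq_zero_add
  have t3 := s3.tsum_eq_zero_add
  have c2 : ps (shift dc) z = dc 1 + ∑' n, shift dc (n+1) * z^(n+1) := by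
    rw [ps, t2]; simp [shift]
  have c3 : ps Qc z = Qc 0 + ∑' n, Qc (n+1) * z^(n+1) := by
    rw [ps, t3]; simp
  have h0 := dc_succ 0
  simp at h0
  have s2' := (summable_nat_add_iff 1).2 s2
  have s3' := (summable_nat_add_iff 1).2 s3
  have key : 4 * z * ps (shift (shift dc)) z + 10 * ∑' n, shift dc (n+1) * z^(n+1) =
     -3 * (∑' n, Qc (n+1) * z^(n+1)) + z * ps Tc z := by
    rw [ps, ps, ← tsum_mul_left, ← tsum_mul_left, ← tsum_mul_left, ← tsum_mul_left,
      ← (s1.mul_left _).tsum_add (s2'.mul_left _), ← (s3'.mul_left _).tsum_add (s4.mul_left _)]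
    congr 1; ext n
    have h := dc_succ (n+1)
    simp at h
    simp only [shift]
    push_cast
    rw [pow_succ]
    linear_combination (z * z^n) * h
  rw [c2, c3]
  linear_combination key + h0

/-- The regular singular solution, in the variable `z = t²`. -/
noncomputable def AA (z : ℝ) : ℝ := z * ps dc z
noncomputable def AA1 (z : ℝ) : ℝ := ps dc z + z * ps (shift dc) z
noncomputable def AA2 (z : ℝ) : ℝ := 2 * ps (shift dc) z + z * ps (shift (shift dc)) z

lemma AA_deriv {z : ℝ} (hz : |z| < 2) : HasDerivAt AA (AA1 z) z := by
  have := (hasDerivAt_id z).mul (ps_deriv dc_adm hz)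
  have e : AA1 z = 1 * ps dc z + id z * ps (shift dc) z := by simp [AA1]
  rw [e]; exact this
lemma AA1_deriv {z : ℝ} (hz : |z| < 2) : HasDerivAt AA1 (AA2 z) z := by
  have := (ps_deriv dc_adm hz).add ((hasDerivAt_id z).mul (ps_deriv dc_adm.shift hz))
  have e : AA2 z = ps (shift dc) z + (1 * ps (shift dc) z + id z * ps (shift (shift dc)) z) := by
    simp [AA2]; ring
  rw [e]; exact this
lemma AA_ode {z : ℝ} (hz : |z| < 2) :
    4 * z^2 * AA2 z + 2 * z * AA1 z = 2 * AA z - 3 * AA z ^ 2 + AA z ^ 3 := by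
  have := D_ode hz
  simp only [AA, AA1, AA2]
  linear_combination z^2 * this
lemma ps_zero (a : ℕ → ℝ) : ps a 0 = a 0 := by
  rw [ps, tsum_eq_single 0]
  · simp
  · intro n hn; simp [hn]
lemma AA_zero : AA 0 = 0 := by simp [AA]
lemma AA1_zero : AA1 0 = 1 := by simp [AA1, ps_zero, dc_zero]
lemma AA_contDiffOn : ContDiffOn ℝ (⊤ : ℕ∞) AA (Set.Ioo (-2) 2) := by
  rw [contDiffOn_infty]
  intro n
  exact contDiffOn_id.mul (ps_contDiffOn n dc_adm)

lemma AA1_bound {z : ℝ} (h0 : 0 ≤ z) (h1 : z ≤ 1/5) : |AA1 z - 1| ≤ 24/100 := by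
  have hz : |z| < 2 := by rw [abs_of_nonneg h0]; linarith
  have s1 := (dc_adm.summable hz).of_abs
  have s2 := (dc_adm.shift.summable hz).of_abs
  have s1' := (summable_nat_add_iff 1).2 s1
  have e : AA1 z - 1 = ∑' n : ℕ, (n+2) * dc (n+1) * z^(n+1) := by
    have : ps dc z = 1 + ∑' n, dc (n+1) * z^(n+1) := by
      rw [ps, s1.tsum_eq_zero_add]; simp [dc_zero]
    rw [AA1, this, ps, ← tsum_mul_left, add_assoc, ← s1'.tsum_add (s2.mul_left _)]
    simp only [add_sub_cancel_left]
    congr 1; ext n; simp only [shift]; rw [pow_succ]; ring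
  rw [e]
  have g := hasSum_geometric_of_lt_one (by norm_num : (0:ℝ) ≤ 3/20) (by norm_num)
  have hb : ∀ n : ℕ, ‖((n:ℝ)+2) * dc (n+1) * z^(n+1)‖ ≤ 1/5 * (3/20)^n := by
    intro n
    have b1 := dc_bound (n+1)
    have b2 : ((n:ℝ)+2) ≤ 2 * (3/2)^n := by
      have := one_add_mul_le_pow (a := (1/2:ℝ)) (by norm_num) n
      norm_num at this
      linarith
    rw [Real.norm_eq_abs, abs_mul, abs_mul, abs_of_nonneg (by positivity : (0:ℝ) ≤ (n:ℝ)+2), abs_pow, abs_of_nonneg h0]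
    calc ((n:ℝ)+2) * |dc (n+1)| * z^(n+1) ≤ (2 * (3/2)^n) * (1/2)^(n+1) * (1/5)^(n+1) := by gcongr
      _ = 1/5 * (3/20)^n := by
        rw [pow_succ, pow_succ, show (3/20:ℝ) = 3/2 * (1/2) * (1/5) by norm_num, mul_pow, mul_pow]; ring
  have := tsum_of_norm_bounded (g.mul_left (1/5)) hb
  rw [Real.norm_eq_abs] at this
  refine this.trans (by norm_num)

end XC
namespace XC
open MeasureTheory

/-- the concentrated bump -/
noncomputable def bb (h r : ℝ) : ℝ := 2*h^2/((r^2+h^2)*Real.sqrt (r^2+h^2))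

lemma bb_prim {h : ℝ} (hh : 0 < h) (r : ℝ) :
    HasDerivAt (fun r => 2 * (r / Real.sqrt (r^2+h^2))) (bb h r) r := by
  have hp : 0 < r^2+h^2 := by positivity
  have hs : 0 < Real.sqrt (r^2+h^2) := Real.sqrt_pos.2 hp
  have h1 : HasDerivAt (fun r : ℝ => r^2+h^2) (2*r) r := by
    simpa using (hasDerivAt_pow 2 r).add_const (h^2)
  have h2 := ((hasDerivAt_id r).div (h1.sqrt hp.ne') hs.ne').const_mul 2
  refine HasDerivAt.congr_deriv h2 ?_
  have e := Real.sq_sqrt hp.le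
  rw [bb]
  simp only [id]
  set s := Real.sqrt (r^2+h^2)
  rw [← e]
  field_simp
  rw [e]; ring

lemma bb_prim1 {h : ℝ} (hh : 0 < h) (r : ℝ) :
    HasDerivAt (fun r => 2 * h^2 / Real.sqrt (r^2+h^2)) (-r * bb h r) r := by
  have hp : 0 < r^2+h^2 := by positivity
  have hs : 0 < Real.sqrt (r^2+h^2) := Real.sqrt_pos.2 hp
  have h1 : HasDerivAt (fun r : ℝ => r^2+h^2) (2*r) r := by
    simpa using (hasDerivAt_pow 2 r).add_const (h^2)
  have h2 := ((h1.sqrt hp.ne').inv hs.ne').const_mul (2*h^2)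
  refine HasDerivAt.congr_deriv h2 ?_
  have e := Real.sq_sqrt hp.le
  rw [bb]
  set s := Real.sqrt (r^2+h^2)
  rw [← e]
  field_simp

lemma bb_contDiff {h : ℝ} (hh : 0 < h) : ContDiff ℝ (⊤ : ℕ∞) (bb h) := by
  have hp : ∀ r : ℝ, 0 < r^2+h^2 := fun r => by positivity
  have : ContDiff ℝ (⊤ : ℕ∞) (fun r : ℝ => r^2+h^2) := by fun_prop
  refine contDiff_const.div (this.mul (this.sqrt fun r => (hp r).ne')) fun r => ?_
  have := Real.sqrt_pos.2 (hp r)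
  have := hp r
  positivity

lemma bb_pos {h : ℝ} (hh : 0 < h) (r : ℝ) : 0 < bb h r := by
  have hp : 0 < r^2+h^2 := by positivity
  have := Real.sqrt_pos.2 hp
  rw [bb]; positivity

noncomputable def chi (η r : ℝ) : ℝ := Real.smoothTransition ((-7/8 + η - r)/η)

lemma chi_one {η r : ℝ} (hη : 0 < η) (h : r ≤ -7/8) : chi η r = 1 :=
  Real.smoothTransition.one_of_one_le (by rw [le_div_iff₀ hη]; linarith)
lemma chi_zero {η r : ℝ} (hη : 0 < η) (h : -7/8 + η ≤ r) : chi η r = 0 :=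
  Real.smoothTransition.zero_of_nonpos (div_nonpos_of_nonpos_of_nonneg (by linarith) hη.le)
lemma chi_nonneg (η r : ℝ) : 0 ≤ chi η r := Real.smoothTransition.nonneg _
lemma chi_le (η r : ℝ) : chi η r ≤ 1 := Real.smoothTransition.le_one _
lemma chi_contDiff (η : ℝ) : ContDiff ℝ (⊤ : ℕ∞) (chi η) := by
  refine Real.smoothTransition.contDiff.comp ?_
  fun_prop

noncomputable def pw (η h r : ℝ) : ℝ :=
  chi η r * ((1+r)^2)⁻¹ + chi η (-r) * ((1-r)^2)⁻¹ + (1 - chi η r) * (1 - chi η (-r)) * bb h r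

lemma pw_exists : ∃ p : ℝ → ℝ, ContDiffOn ℝ (⊤ : ℕ∞) p (Set.Ioo (-1) 1) ∧
    (∀ r ∈ Set.Ioo (-1:ℝ) 1, 0 < p r) ∧ (∀ r, p (-r) = p r) ∧
    (∀ r, r ≤ -7/8 → p r = ((r+1)^2)⁻¹) ∧
    18/10 ≤ ∫ s in (-7/8:ℝ)..0, p s ∧ ∫ s in (-7/8:ℝ)..0, p s ≤ 21/10 ∧
    ∫ s in (-7/8:ℝ)..0, -s * p s ≤ 1/1000 := by
  set h : ℝ := 1/10000 with hh
  set η : ℝ := 1/1000000 with hη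
  have h0 : 0 < h := by norm_num [hh]
  have η0 : 0 < η := by norm_num [hη]
  have hsm : ContDiffOn ℝ (⊤ : ℕ∞) (pw η h) (Set.Ioo (-1) 1) := by
    have c1 := chi_contDiff η
    have c2 : ContDiff ℝ (⊤ : ℕ∞) (fun r => chi η (-r)) := c1.comp contDiff_neg
    have c3 := bb_contDiff h0
    refine ContDiffOn.add (ContDiffOn.add (c1.contDiffOn.mul ?_) (c2.contDiffOn.mul ?_)) ?_
    · refine ContDiffOn.inv (by fun_prop) fun r hr => ?_
      have : 0 < 1 + r := by linarith [hr.1]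
      positivity
    · refine ContDiffOn.inv (by fun_prop) fun r hr => ?_
      have : 0 < 1 - r := by linarith [hr.2]
      positivity
    · exact (((contDiff_const.sub c1).mul (contDiff_const.sub c2)).mul c3).contDiffOn
  have hcont : ContinuousOn (pw η h) (Set.Icc (-7/8) 0) :=
    hsm.continuousOn.mono fun r hr => ⟨by linarith [hr.1], by linarith [hr.2]⟩
  have hpint : ∀ a b : ℝ, -7/8 ≤ a → a ≤ b → b ≤ 0 → IntervalIntegrable (pw η h) volume a b :=
    fun a b h1 h2 h3 => (hcont.mono (by rw [Set.uIcc_of_le h2]; exact Set.Icc_subset_Icc h1 h3)).intervalIntegrable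
  have hpint1 : ∀ a b : ℝ, -7/8 ≤ a → a ≤ b → b ≤ 0 → IntervalIntegrable (fun s => -s * pw η h s) volume a b :=
    fun a b h1 h2 h3 => ((continuousOn_id.neg.mul hcont).mono (by rw [Set.uIcc_of_le h2]; exact Set.Icc_subset_Icc h1 h3)).intervalIntegrable
  have bint : ∀ a b : ℝ, IntervalIntegrable (bb h) volume a b := fun a b => (bb_contDiff h0).continuous.intervalIntegrable a b
  have bint1 : ∀ a b : ℝ, IntervalIntegrable (fun s => -s * bb h s) volume a b := fun a b => (continuous_neg.mul (bb_contDiff h0).continuous).intervalIntegrable a b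
  have If : ∀ a b : ℝ, ∫ s in a..b, bb h s = 2 * (b / Real.sqrt (b^2+h^2)) - 2 * (a / Real.sqrt (a^2+h^2)) :=
    fun a b => intervalIntegral.integral_eq_sub_of_hasDerivAt (fun x _ => bb_prim h0 x) (bint a b)
  have If1 : ∀ a b : ℝ, ∫ s in a..b, -s * bb h s = 2 * h^2 / Real.sqrt (b^2+h^2) - 2 * h^2 / Real.sqrt (a^2+h^2) :=
    fun a b => intervalIntegral.integral_eq_sub_of_hasDerivAt (fun x _ => bb_prim1 h0 x) (bint1 a b)
  have hR : ∀ s, s ≤ 0 → chi η (-s) = 0 := fun s hs => chi_zero η0 (by rw [hη]; linarith)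
  have pin : ∀ s, -7/8+η ≤ s → s ≤ 0 → pw η h s = bb h s := fun s h1 h2 => by
    rw [pw, hR s h2, chi_zero η0 h1]; ring
  have pup : ∀ s, -7/8 ≤ s → s ≤ 0 → pw η h s ≤ 64 + bb h s := fun s h1 h2 => by
    rw [pw, hR s h2]
    have : ((1+s)^2)⁻¹ ≤ 64 := by
      rw [show (64:ℝ) = ((1/8)^2)⁻¹ by norm_num]
      gcongr
      linarith
    have h3 := chi_nonneg η s
    have h4 := chi_le η s
    have h5 := bb_pos h0 s
    have : chi η s * ((1+s)^2)⁻¹ ≤ 1 * 64 := mul_le_mul h4 this (by positivity) (by norm_num)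
    nlinarith
  have hpos : ∀ r ∈ Set.Ioo (-1:ℝ) 1, 0 < pw η h r := by
    intro r hr
    have b := bb_pos h0 r
    have e1 : 0 < ((1+r)^2)⁻¹ := by have : 0 < 1 + r := by linarith [hr.1]
                                    positivity
    have e2 : 0 < ((1-r)^2)⁻¹ := by have : 0 < 1 - r := by linarith [hr.2]
                                    positivity
    rw [pw]
    have a1 := chi_nonneg η r
    have a2 := chi_le η r
    have a3 := chi_nonneg η (-r)
    have a4 := chi_le η (-r)
    rcases a1.eq_or_lt with h1 | h1
    · rcases a3.eq_or_lt with h3 | h3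
      · rw [← h1, ← h3]; simpa using b
      · have := mul_pos h3 e2
        have := mul_nonneg a1 e1.le
        have := mul_nonneg (mul_nonneg (sub_nonneg.2 a2) (sub_nonneg.2 a4)) b.le
        linarith
    · have := mul_pos h1 e1
      have := mul_nonneg a3 e2.le
      have := mul_nonneg (mul_nonneg (sub_nonneg.2 a2) (sub_nonneg.2 a4)) b.le
      linarith
  have hη1 : -7/8+η ≤ 0 := by rw [hη]; norm_num
  have split : ∫ s in (-7/8:ℝ)..0, pw η h s = (∫ s in (-7/8:ℝ)..(-7/8+η), pw η h s) + ∫ s in (-7/8+η)..0, bb h s := by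
    rw [← intervalIntegral.integral_add_adjacent_intervals (hpint (-7/8) (-7/8+η) le_rfl (by linarith) hη1) (hpint (-7/8+η) 0 (by linarith) hη1 le_rfl)]
    congr 1
    refine intervalIntegral.integral_congr fun s hs => ?_
    rw [Set.uIcc_of_le hη1] at hs
    exact pin s hs.1 hs.2
  have split1 : ∫ s in (-7/8:ℝ)..0, -s * pw η h s = (∫ s in (-7/8:ℝ)..(-7/8+η), -s * pw η h s) + ∫ s in (-7/8+η)..0, -s * bb h s := by
    rw [← intervalIntegral.integral_add_adjacent_intervals (hpint1 (-7/8) (-7/8+η) le_rfl (by linarith) hη1) (hpint1 (-7/8+η) 0 (by linarith) hη1 le_rfl)]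
    congr 1
    refine intervalIntegral.integral_congr fun s hs => ?_
    rw [Set.uIcc_of_le hη1] at hs
    show -s * pw η h s = -s * bb h s
    rw [pin s hs.1 hs.2]
  refine ⟨pw η h, hsm, hpos, ?_, ?_, ?_, ?_, ?_⟩
  · intro r
    have : bb h (-r) = bb h r := by simp [bb]
    rw [pw, pw, this, neg_neg]; ring_nf
  · intro r hr
    rw [pw, hR r (by linarith), chi_one η0 hr]; ring_nf
  · rw [split, If]
    have n1 : 0 ≤ ∫ s in (-7/8:ℝ)..(-7/8+η), pw η h s := by
      refine intervalIntegral.integral_nonneg (by linarith) fun s hs => (hpos s ⟨by linarith [hs.1], by linarith [hs.2]⟩).le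
    have n2 : Real.sqrt ((-7/8+η)^2+h^2) ≤ 88/100 := by
      rw [Real.sqrt_le_left (by norm_num)]; rw [hη, hh]; norm_num
    have n3 : 0 < Real.sqrt ((-7/8+η)^2+h^2) := Real.sqrt_pos.2 (by positivity)
    have n4 : (-7/8+η) / Real.sqrt ((-7/8+η)^2+h^2) ≤ -9/10 := by
      rw [div_le_iff₀ n3, hη]
      linarith
    simp only [zero_div, mul_zero]
    linarith
  · rw [split, If]
    have n1 : ∫ s in (-7/8:ℝ)..(-7/8+η), pw η h s ≤ ∫ s in (-7/8:ℝ)..(-7/8+η), (64 + bb h s) := by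
      refine intervalIntegral.integral_mono_on (by linarith) (hpint _ _ le_rfl (by linarith) hη1) ((intervalIntegrable_const).add (bint _ _)) fun s hs => pup s hs.1 (by linarith [hs.2])
    rw [intervalIntegral.integral_add (intervalIntegrable_const) (bint _ _), If, intervalIntegral.integral_const] at n1
    simp only [zero_div, mul_zero, smul_eq_mul] at n1 ⊢
    have n3 : 0 < Real.sqrt ((-7/8)^2+h^2) := Real.sqrt_pos.2 (by positivity)
    have n5 : 7/8 ≤ Real.sqrt ((-7/8)^2+h^2) := Real.le_sqrt_of_sq_le (by nlinarith [sq_nonneg h])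
    have n4 : -1 ≤ (-7/8) / Real.sqrt ((-7/8)^2+h^2) := by
      rw [le_div_iff₀ n3]
      linarith
    linarith
  · rw [split1, If1]
    have n1 : ∫ s in (-7/8:ℝ)..(-7/8+η), -s * pw η h s ≤ ∫ s in (-7/8:ℝ)..(-7/8+η), (64 + -s * bb h s) := by
      refine intervalIntegral.integral_mono_on (by linarith) (hpint1 _ _ le_rfl (by linarith) hη1) ((intervalIntegrable_const).add (bint1 _ _)) fun s hs => ?_
      have := pup s hs.1 (by linarith [hs.2])
      have h1 : 0 ≤ -s := by linarith [hs.2]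
      have h2 : -s ≤ 1 := by linarith [hs.1]
      nlinarith [mul_le_mul_of_nonneg_left this h1]
    rw [intervalIntegral.integral_add (intervalIntegrable_const) (bint1 _ _), If1, intervalIntegral.integral_const] at n1
    simp only [smul_eq_mul] at n1 ⊢
    have n3 : 0 ≤ 2 * h^2 / Real.sqrt ((-7/8)^2+h^2) := by positivity
    have n4 : 2 * h^2 / Real.sqrt (0^2+h^2) = 2 * h := by
      rw [zero_pow (by norm_num), zero_add, Real.sqrt_sq h0.le]; field_simp
    linarith
end XC
namespace XC
open MeasureTheory

/-- truncated nonlinearity -/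
noncomputable def clip (x : ℝ) : ℝ := max (-1) (min x 1)
noncomputable def F (x : ℝ) : ℝ := clip x ^ 3 - clip x

lemma clip_mem (x : ℝ) : -1 ≤ clip x ∧ clip x ≤ 1 := ⟨le_max_left _ _, max_le (by norm_num) (min_le_right _ _)⟩
lemma clip_lip (x y : ℝ) : |clip x - clip y| ≤ |x - y| := by
  have h1 := abs_max_sub_max_le_abs (min x 1) (min y 1) (-1)
  have h2 := abs_min_sub_min_le_max x 1 y 1
  simp only [sub_self, abs_zero] at h2
  rw [max_eq_left (abs_nonneg _)] at h2
  rw [clip, clip, max_comm, max_comm (-1)]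
  exact h1.trans h2
lemma clip_cont : Continuous clip := by unfold clip; fun_prop
lemma F_cont : Continuous F := by unfold F; exact (clip_cont.pow 3).sub clip_cont
lemma F_lip (x y : ℝ) : |F x - F y| ≤ 2 * |x - y| := by
  have h : F x - F y = (clip x - clip y) * (clip x^2 + clip x * clip y + clip y^2 - 1) := by
    simp only [F]; ring
  rw [h, abs_mul, mul_comm]
  refine mul_le_mul ?_ (clip_lip x y) (abs_nonneg _) (by norm_num)
  obtain ⟨a1, a2⟩ := clip_mem x
  obtain ⟨b1, b2⟩ := clip_mem y
  rw [abs_le]; constructor <;> nlinarith [sq_nonneg (clip x + clip y), sq_nonneg (clip x - clip y)]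
lemma F_bound (x : ℝ) : |F x| ≤ 2/5 := by
  obtain ⟨a1, a2⟩ := clip_mem x
  simp only [F]
  rw [abs_le]; constructor
  · nlinarith [mul_nonneg (by linarith : 0 ≤ clip x + 1.2) (sq_nonneg (clip x - 0.577))]
  · nlinarith [mul_nonneg (by linarith : 0 ≤ 1.2 - clip x) (sq_nonneg (clip x + 0.577))]
lemma clip_eq {x : ℝ} (h1 : -1 ≤ x) (h2 : x ≤ 1) : clip x = x := by
  rw [clip, min_eq_left h2, max_eq_right h1]
lemma F_eq {x : ℝ} (h1 : -1 ≤ x) (h2 : x ≤ 1) : F x = x^3 - x := by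
  rw [F, clip_eq h1 h2]
lemma F_nonneg {x : ℝ} (h : x ≤ 0) : 0 ≤ F x := by
  have : clip x ≤ 0 := max_le (by norm_num) ((min_le_left _ _).trans h)
  obtain ⟨a1, a2⟩ := clip_mem x
  rw [F]
  nlinarith [mul_nonneg (neg_nonneg.2 this) (by nlinarith : 0 ≤ 1 - clip x^2)]

lemma ker_bound {q : ℝ → ℝ} (hq : Continuous q) (q0 : ∀ s, 0 ≤ q s) {w : ℝ → ℝ} (hw : Continuous w) {d : ℝ}
    (hd : ∀ s ∈ Set.Icc (-7/8:ℝ) 0, |w s| ≤ d) {r : ℝ} (hr : r ∈ Set.Icc (-7/8:ℝ) 0) :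
    |∫ s in (-7/8:ℝ)..r, (r - s) * (q s * w s)| ≤ d * ∫ s in (-7/8:ℝ)..0, -s * q s := by
  have d0 : 0 ≤ d := (abs_nonneg _).trans (hd r hr)
  calc |∫ s in (-7/8:ℝ)..r, (r - s) * (q s * w s)| ≤ ∫ s in (-7/8:ℝ)..r, |(r - s) * (q s * w s)| :=
        intervalIntegral.abs_integral_le_integral_abs hr.1
    _ ≤ ∫ s in (-7/8:ℝ)..r, d * (-s * q s) := by
        refine intervalIntegral.integral_mono_on hr.1 (Continuous.intervalIntegrable (by fun_prop) _ _) (Continuous.intervalIntegrable (by fun_prop) _ _) fun s hs => ?_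
        have h1 := hd s ⟨hs.1, hs.2.trans hr.2⟩
        rw [abs_mul, abs_mul, abs_of_nonneg (by linarith [hs.2] : 0 ≤ r - s), abs_of_nonneg (q0 s)]
        have h2 : (r - s) ≤ -s := by linarith [hr.2]
        have h3 : q s * |w s| ≤ q s * d := mul_le_mul_of_nonneg_left h1 (q0 s)
        calc (r-s) * (q s * |w s|) ≤ (-s) * (q s * d) :=
              mul_le_mul h2 h3 (mul_nonneg (q0 s) (abs_nonneg _)) (by linarith [hs.2, hr.2])
          _ = _ := by ring
    _ ≤ ∫ s in (-7/8:ℝ)..0, d * (-s * q s) := by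
        refine intervalIntegral.integral_mono_interval le_rfl hr.1 hr.2 ?_ (Continuous.intervalIntegrable (by fun_prop) _ _)
        refine (ae_restrict_iff' measurableSet_Ioc).2 (Filter.Eventually.of_forall fun s hs => ?_)
        exact mul_nonneg d0 (mul_nonneg (by linarith [hs.2]) (q0 s))
    _ = _ := by rw [intervalIntegral.integral_const_mul]

lemma ode_exists {q : ℝ → ℝ} (hq : Continuous q) (q0 : ∀ s, 0 ≤ q s)
    (hM : ∫ s in (-7/8:ℝ)..0, -s * q s ≤ 1/1000) (x y : ℝ) :
    ∃ u v : ℝ → ℝ, (∀ r, HasDerivAt u (v r) r) ∧ Continuous v ∧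
      (∀ r ∈ Set.Icc (-7/8:ℝ) 0, HasDerivAt v (q r * F (u r)) r) ∧
      u (-7/8) = x ∧ v (-7/8) = y ∧
      (∀ r ∈ Set.Icc (-7/8:ℝ) 0, u r = x + y * (r + 7/8) + ∫ s in (-7/8:ℝ)..r, (r - s) * (q s * F (u s))) ∧
      (∀ r ∈ Set.Icc (-7/8:ℝ) 0, v r = y + ∫ s in (-7/8:ℝ)..r, q s * F (u s)) := by
  have hab : (-7/8:ℝ) ≤ 0 := by norm_num
  -- the formula
  let W : (ℝ → ℝ) → ℝ → ℝ := fun w r => x + y * (r + 7/8) + ∫ s in (-7/8:ℝ)..r, (r - s) * (q s * F (w s))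
  let V : (ℝ → ℝ) → ℝ → ℝ := fun w r => y + ∫ s in (-7/8:ℝ)..r, q s * F (w s)
  have hF := F_cont
  have Vd : ∀ w : ℝ → ℝ, Continuous w → ∀ r, HasDerivAt (V w) (q r * F (w r)) r := by
    intro w hw r
    have hc : Continuous (fun s => q s * F (w s)) := by fun_prop
    exact (intervalIntegral.integral_hasDerivAt_right (hc.intervalIntegrable _ _) (hc.stronglyMeasurableAtFilter _ _) hc.continuousAt).const_add y
  have Wd : ∀ w : ℝ → ℝ, Continuous w → ∀ r, HasDerivAt (W w) (V w r) r := by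
    intro w hw r
    have hc : Continuous (fun s => q s * F (w s)) := by fun_prop
    have hc1 : Continuous (fun s => s * (q s * F (w s))) := by fun_prop
    have e : W w = fun r => x + y * (r + 7/8) + (r * (∫ s in (-7/8:ℝ)..r, q s * F (w s)) - ∫ s in (-7/8:ℝ)..r, s * (q s * F (w s))) := by
      funext r
      simp only [W]
      rw [← intervalIntegral.integral_const_mul, ← intervalIntegral.integral_sub (Continuous.intervalIntegrable (by fun_prop) _ _) (Continuous.intervalIntegrable (by fun_prop) _ _)]
      congr 2; funext s; ring
    rw [e]
    have d1 := (intervalIntegral.integral_hasDerivAt_right (hc.intervalIntegrable (-7/8) r) (hc.stronglyMeasurableAtFilter _ _) hc.continuousAt)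
    have d2 := (intervalIntegral.integral_hasDerivAt_right (hc1.intervalIntegrable (-7/8) r) (hc1.stronglyMeasurableAtFilter _ _) hc1.continuousAt)
    have d3 := (((hasDerivAt_id r).add_const (7/8)).const_mul y).const_add x
    have d4 := d3.add (((hasDerivAt_id r).mul d1).sub d2)
    refine d4.congr_deriv ?_
    simp only [V, id]; ring
  -- contraction on C(Icc)
  let ext : C(Set.Icc (-7/8:ℝ) 0, ℝ) → ℝ → ℝ := fun g s => g (Set.projIcc (-7/8) 0 hab s)
  have ec : ∀ g, Continuous (ext g) := fun g => g.continuous.comp continuous_projIcc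
  let T : C(Set.Icc (-7/8:ℝ) 0, ℝ) → C(Set.Icc (-7/8:ℝ) 0, ℝ) := fun g =>
    ⟨fun r => W (ext g) r, (continuous_iff_continuousAt.2 fun r => (Wd _ (ec g) r).continuousAt).comp continuous_subtype_val⟩
  have hT : ContractingWith (1/2) T := by
    refine ⟨by norm_num, LipschitzWith.of_dist_le_mul fun g1 g2 => ?_⟩
    rw [ContinuousMap.dist_le (by positivity)]
    intro r
    rw [Real.dist_eq]
    have e : (T g1) r - (T g2) r = ∫ s in (-7/8:ℝ)..r, ((r:ℝ) - s) * (q s * (F (ext g1 s) - F (ext g2 s))) := by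
      have c1 := ec g1
      have c2 := ec g2
      simp only [T, W, ContinuousMap.coe_mk]
      rw [add_sub_add_left_eq_sub, ← intervalIntegral.integral_sub (Continuous.intervalIntegrable (by fun_prop) _ _) (Continuous.intervalIntegrable (by fun_prop) _ _)]
      congr 1; funext s; ring
    rw [e]
    have c1 := ec g1
    have c2 := ec g2
    have := ker_bound hq q0 (w := fun s => F (ext g1 s) - F (ext g2 s)) (by fun_prop) (d := 2 * dist g1 g2)
      (fun s hs => (F_lip _ _).trans (by
        have := ContinuousMap.dist_apply_le_dist (f := g1) (g := g2) (Set.projIcc (-7/8) 0 hab s)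
        rw [Real.dist_eq] at this
        linarith)) r.2
    refine this.trans ?_
    have hd : 0 ≤ dist g1 g2 := dist_nonneg
    push_cast
    nlinarith
  have hne : Nonempty C(Set.Icc (-7/8:ℝ) 0, ℝ) := ⟨0⟩
  obtain ⟨g, hg⟩ : ∃ g, T g = g := ⟨_, hT.fixedPoint_isFixedPt⟩
  have hgW : ∀ s ∈ Set.Icc (-7/8:ℝ) 0, ext g s = W (ext g) s := by
    intro s hs
    have h1 : ext g s = g ⟨s, hs⟩ := by simp only [ext]; rw [Set.projIcc_of_mem hab hs]
    rw [h1]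
    conv_lhs => rw [← hg]
    rfl
  have hcongr : ∀ r ∈ Set.Icc (-7/8:ℝ) 0, ∀ s ∈ Set.uIcc (-7/8:ℝ) r, ext g s = W (ext g) s := by
    intro r hr s hs
    rw [Set.uIcc_of_le hr.1] at hs
    exact hgW s ⟨hs.1, hs.2.trans hr.2⟩
  refine ⟨W (ext g), V (ext g), Wd _ (ec g), continuous_iff_continuousAt.2 fun r => (Vd _ (ec g) r).continuousAt, ?_, by simp only [W, intervalIntegral.integral_same]; ring, by simp [V], ?_, ?_⟩
  · intro r hr
    rw [← hgW r hr]
    exact Vd _ (ec g) r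
  · intro r hr
    change x + y * (r + 7/8) + _ = _
    congr 1
    refine intervalIntegral.integral_congr fun s hs => ?_
    beta_reduce
    rw [← hcongr r hr s hs]
  · intro r hr
    change y + _ = _
    congr 1
    refine intervalIntegral.integral_congr fun s hs => ?_
    beta_reduce
    rw [← hcongr r hr s hs]
end XC
namespace XC
open MeasureTheory

structure Wt (q : ℝ → ℝ) : Prop where
  cont : Continuous q
  nn : ∀ s, 0 ≤ q s
  lo : 18/10 ≤ ∫ s in (-7/8:ℝ)..0, q s
  up : ∫ s in (-7/8:ℝ)..0, q s ≤ 21/10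
  mom : ∫ s in (-7/8:ℝ)..0, -s * q s ≤ 1/1000

structure Sol (q : ℝ → ℝ) (x y : ℝ) (u v : ℝ → ℝ) : Prop where
  du : ∀ r, HasDerivAt u (v r) r
  cv : Continuous v
  dv : ∀ r ∈ Set.Icc (-7/8:ℝ) 0, HasDerivAt v (q r * F (u r)) r
  ux : u (-7/8) = x
  vy : v (-7/8) = y
  iu : ∀ r ∈ Set.Icc (-7/8:ℝ) 0, u r = x + y * (r + 7/8) + ∫ s in (-7/8:ℝ)..r, (r - s) * (q s * F (u s))
  iv : ∀ r ∈ Set.Icc (-7/8:ℝ) 0, v r = y + ∫ s in (-7/8:ℝ)..r, q s * F (u s)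

lemma Sol.cu {q x y u v} (h : Sol q x y u v) : Continuous u :=
  continuous_iff_continuousAt.2 fun r => (h.du r).continuousAt

lemma Wt.exists {q} (hq : Wt q) (x y : ℝ) : ∃ uv : (ℝ → ℝ) × (ℝ → ℝ), Sol q x y uv.1 uv.2 := by
  obtain ⟨u, v, h1, h2, h3, h4, h5, h6, h7⟩ := ode_exists hq.cont hq.nn hq.mom x y
  exact ⟨(u, v), h1, h2, h3, h4, h5, h6, h7⟩

lemma mass_bound {q : ℝ → ℝ} (hq : Wt q) {w : ℝ → ℝ} (hw : Continuous w) {d : ℝ}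
    (hd : ∀ s ∈ Set.Icc (-7/8:ℝ) 0, |w s| ≤ d) {r : ℝ} (hr : r ∈ Set.Icc (-7/8:ℝ) 0) :
    |∫ s in (-7/8:ℝ)..r, q s * w s| ≤ d * (21/10) := by
  have d0 : 0 ≤ d := (abs_nonneg _).trans (hd r hr)
  have hc := hq.cont
  calc |∫ s in (-7/8:ℝ)..r, q s * w s| ≤ ∫ s in (-7/8:ℝ)..r, |q s * w s| :=
        intervalIntegral.abs_integral_le_integral_abs hr.1
    _ ≤ ∫ s in (-7/8:ℝ)..r, d * q s := by
        refine intervalIntegral.integral_mono_on hr.1 (Continuous.intervalIntegrable (by fun_prop) _ _) (Continuous.intervalIntegrable (by fun_prop) _ _) fun s hs => ?_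
        have h1 := hd s ⟨hs.1, hs.2.trans hr.2⟩
        rw [abs_mul, abs_of_nonneg (hq.nn s), mul_comm]
        exact mul_le_mul_of_nonneg_right h1 (hq.nn s)
    _ ≤ ∫ s in (-7/8:ℝ)..0, d * q s := by
        refine intervalIntegral.integral_mono_interval le_rfl hr.1 hr.2 ?_ (Continuous.intervalIntegrable (by fun_prop) _ _)
        exact (Filter.Eventually.of_forall fun s => mul_nonneg d0 (hq.nn s))
    _ ≤ _ := by rw [intervalIntegral.integral_const_mul]; exact mul_le_mul_of_nonneg_left hq.up d0

lemma Sol.lin {q x y u v} (hq : Wt q) (h : Sol q x y u v) {r : ℝ} (hr : r ∈ Set.Icc (-7/8:ℝ) 0) :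
    |u r - (x + y * (r + 7/8))| ≤ 1/1000 := by
  have hu := h.cu
  have hF := F_cont
  rw [h.iu r hr, add_sub_cancel_left]
  refine (ker_bound hq.cont hq.nn (w := fun s => F (u s)) (by fun_prop) (d := 2/5) (fun s _ => F_bound _) hr).trans ?_
  have := hq.mom
  linarith

lemma Sol.vel {q x y u v} (hq : Wt q) (h : Sol q x y u v) {r : ℝ} (hr : r ∈ Set.Icc (-7/8:ℝ) 0) :
    |v r - y| ≤ 84/100 := by
  have hu := h.cu
  have hF := F_cont
  rw [h.iv r hr, add_sub_cancel_left]
  refine (mass_bound hq (w := fun s => F (u s)) (by fun_prop) (d := 2/5) (fun s _ => F_bound _) hr).trans ?_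
  norm_num

lemma zero_mem : (0:ℝ) ∈ Set.Icc (-7/8:ℝ) 0 := ⟨by norm_num, le_rfl⟩

lemma Sol.diff {q x1 y1 u1 v1 x2 y2 u2 v2} (hq : Wt q) (h1 : Sol q x1 y1 u1 v1) (h2 : Sol q x2 y2 u2 v2)
    (hx : x2 ≤ x1) (hy : y2 ≤ y1) :
    ((x1 - x2) + 7/8 * (y1 - y2))/2 ≤ u1 0 - u2 0 ∧
    u1 0 - u2 0 ≤ 2 * ((x1 - x2) + 7/8 * (y1 - y2)) ∧
    |v1 0 - v2 0| ≤ 20 * (u1 0 - u2 0) := by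
  have hu1 := h1.cu
  have hu2 := h2.cu
  have hF := F_cont
  have hc := hq.cont
  set lin := (x1 - x2) + 7/8 * (y1 - y2) with hlin
  have hl0 : 0 ≤ lin := by rw [hlin]; linarith
  obtain ⟨m, hm, hmax⟩ := (isCompact_Icc (a := (-7/8:ℝ)) (b := 0)).exists_isMaxOn ⟨0, zero_mem⟩
    ((hu1.sub hu2).abs.continuousOn)
  set d := |u1 m - u2 m| with hd
  have hd0 : 0 ≤ d := abs_nonneg _
  have hmax' : ∀ s ∈ Set.Icc (-7/8:ℝ) 0, |u1 s - u2 s| ≤ d := fun s hs => hmax hs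
  have hFd : ∀ s ∈ Set.Icc (-7/8:ℝ) 0, |F (u1 s) - F (u2 s)| ≤ 2 * d :=
    fun s hs => (F_lip _ _).trans (by linarith [hmax' s hs])
  have est : ∀ r ∈ Set.Icc (-7/8:ℝ) 0, |(u1 r - u2 r) - ((x1 - x2) + (r+7/8) * (y1 - y2))| ≤ 2*d/1000 := by
    intro r hr
    have e : (u1 r - u2 r) - ((x1 - x2) + (r+7/8) * (y1 - y2)) = ∫ s in (-7/8:ℝ)..r, (r - s) * (q s * (F (u1 s) - F (u2 s))) := by
      have : ∫ s in (-7/8:ℝ)..r, (r - s) * (q s * (F (u1 s) - F (u2 s))) =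
         (∫ s in (-7/8:ℝ)..r, (r - s) * (q s * F (u1 s))) - ∫ s in (-7/8:ℝ)..r, (r - s) * (q s * F (u2 s)) := by
        rw [← intervalIntegral.integral_sub (Continuous.intervalIntegrable (by fun_prop) _ _) (Continuous.intervalIntegrable (by fun_prop) _ _)]
        congr 1; funext s; ring
      rw [this, h1.iu r hr, h2.iu r hr]; ring
    rw [e]
    refine (ker_bound hq.cont hq.nn (w := fun s => F (u1 s) - F (u2 s)) (by fun_prop) hFd hr).trans ?_
    have := hq.mom
    nlinarith
  have dl : d ≤ 2 * lin := by
    have := est m hm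
    have h3 : |(x1 - x2) + (m+7/8) * (y1 - y2)| ≤ lin := by
      rw [abs_of_nonneg (add_nonneg (by linarith) (mul_nonneg (by linarith [hm.1]) (by linarith)))]
      have := mul_nonneg (sub_nonneg.2 hm.2) (sub_nonneg.2 hy)
      rw [hlin]; nlinarith
    have h4 : d ≤ |(u1 m - u2 m) - ((x1 - x2) + (m+7/8) * (y1 - y2))| + |(x1 - x2) + (m+7/8) * (y1 - y2)| := by
      have := abs_add_le ((u1 m - u2 m) - ((x1 - x2) + (m+7/8) * (y1 - y2))) ((x1 - x2) + (m+7/8) * (y1 - y2))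
      rwa [sub_add_cancel] at this
    linarith
  have e0 := abs_le.1 (est 0 zero_mem)
  have a1 : lin / 2 ≤ u1 0 - u2 0 := by
    have := e0.1
    linarith
  have a2 : u1 0 - u2 0 ≤ 2 * lin := by
    have := e0.2
    linarith
  refine ⟨a1, a2, ?_⟩
  have ev : v1 0 - v2 0 = (y1 - y2) + ∫ s in (-7/8:ℝ)..0, q s * (F (u1 s) - F (u2 s)) := by
    have : ∫ s in (-7/8:ℝ)..0, q s * (F (u1 s) - F (u2 s)) =
       (∫ s in (-7/8:ℝ)..0, q s * F (u1 s)) - ∫ s in (-7/8:ℝ)..0, q s * F (u2 s) := by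
      rw [← intervalIntegral.integral_sub (Continuous.intervalIntegrable (by fun_prop) _ _) (Continuous.intervalIntegrable (by fun_prop) _ _)]
      congr 1; funext s; ring
    rw [this, h1.iv 0 zero_mem, h2.iv 0 zero_mem]; ring
  have b := mass_bound hq (w := fun s => F (u1 s) - F (u2 s)) (by fun_prop) hFd zero_mem
  rw [ev]
  refine (abs_add_le _ _).trans ?_
  rw [abs_of_nonneg (sub_nonneg.2 hy)]
  linarith

lemma Sol.end_est {q x y u v} (hq : Wt q) (h : Sol q x y u v) (y0 : 0 ≤ y) (y4 : y ≤ 4) :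
    |v 0 - y - (∫ s in (-7/8:ℝ)..0, q s) * F (u 0)| ≤ 1/100 := by
  have hu := h.cu
  have hF := F_cont
  have hc := hq.cont
  have e : v 0 - y - (∫ s in (-7/8:ℝ)..0, q s) * F (u 0) = ∫ s in (-7/8:ℝ)..0, q s * (F (u s) - F (u 0)) := by
    rw [h.iv 0 zero_mem, ← intervalIntegral.integral_mul_const, add_sub_cancel_left,
      ← intervalIntegral.integral_sub (Continuous.intervalIntegrable (by fun_prop) _ _) (Continuous.intervalIntegrable (by fun_prop) _ _)]
    congr 1; funext s; ring
  have lip : ∀ s ∈ Set.Icc (-7/8:ℝ) 0, |u s - u 0| ≤ 5 * (-s) := by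
    intro s hs
    have := Convex.norm_image_sub_le_of_norm_hasDerivWithin_le (f := u) (f' := v) (C := 5) (s := Set.Icc (-7/8:ℝ) 0)
      (x := 0) (y := s) (fun r _ => (h.du r).hasDerivWithinAt) (fun r hr => by
        have := abs_le.1 (h.vel hq hr)
        rw [Real.norm_eq_abs, abs_le]; constructor <;> linarith [this.1, this.2]) (convex_Icc _ _) zero_mem hs
    rw [Real.norm_eq_abs, Real.norm_eq_abs, sub_zero, abs_of_nonpos hs.2] at this
    exact this
  rw [e]
  calc |∫ s in (-7/8:ℝ)..0, q s * (F (u s) - F (u 0))| ≤ ∫ s in (-7/8:ℝ)..0, |q s * (F (u s) - F (u 0))| :=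
        intervalIntegral.abs_integral_le_integral_abs (by norm_num)
    _ ≤ ∫ s in (-7/8:ℝ)..0, 10 * (-s * q s) := by
        refine intervalIntegral.integral_mono_on (by norm_num) (Continuous.intervalIntegrable (by fun_prop) _ _) (Continuous.intervalIntegrable (by fun_prop) _ _) fun s hs => ?_
        rw [abs_mul, abs_of_nonneg (hq.nn s)]
        have := (F_lip (u s) (u 0)).trans (mul_le_mul_of_nonneg_left (lip s hs) (by norm_num))
        nlinarith [mul_le_mul_of_nonneg_left this (hq.nn s)]
    _ ≤ _ := by rw [intervalIntegral.integral_const_mul]; linarith [hq.mom]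

lemma Sol.vpos {q x y u v} (hq : Wt q) (h : Sol q x y u v) (y0 : 0 < y) (hx : x + 1 ≤ y/9)
    {r : ℝ} (hr : r ∈ Set.Icc (-7/8:ℝ) 0) : 0 < v r := by
  rcases le_or_gt (9/10) y with hy | hy
  · linarith [(abs_le.1 (h.vel hq hr)).1]
  · rw [h.iv r hr]
    have : 0 ≤ ∫ s in (-7/8:ℝ)..r, q s * F (u s) := by
      refine intervalIntegral.integral_nonneg hr.1 fun s hs => mul_nonneg (hq.nn s) (F_nonneg ?_)
      have hs' : s ∈ Set.Icc (-7/8:ℝ) 0 := ⟨hs.1, hs.2.trans hr.2⟩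
      have := (abs_le.1 (h.lin hq hs')).2
      nlinarith [mul_nonneg y0.le (neg_nonneg.2 hs'.2)]
    linarith

lemma Sol.mem {q x y u v} (hq : Wt q) (h : Sol q x y u v) (y0 : 0 < y) (hx : x + 1 ≤ y/9)
    {r : ℝ} (hr : r ∈ Set.Icc (-7/8:ℝ) 0) : x ≤ u r ∧ u r ≤ u 0 := by
  have hm : MonotoneOn u (Set.Icc (-7/8:ℝ) 0) := by
    refine monotoneOn_of_deriv_nonneg (convex_Icc _ _) h.cu.continuousOn
      (fun s _ => (h.du s).differentiableAt.differentiableWithinAt) fun s hs => ?_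
    rw [(h.du s).deriv]
    exact (h.vpos hq y0 hx (interior_subset hs)).le
  exact ⟨h.ux ▸ hm ⟨le_rfl, by norm_num⟩ hr hr.1, hm hr zero_mem hr.2⟩

/-- shooting data at `-7/8` -/
noncomputable def sx (z : ℝ) : ℝ := -1 + AA z
noncomputable def sy (z : ℝ) : ℝ := 16 * z * AA1 z

lemma small {z : ℝ} (h : z ∈ Set.Icc (0:ℝ) (1/5)) : |z| < 2 := by
  rw [abs_of_nonneg h.1]; linarith [h.2]

lemma AA_bounds {z : ℝ} (h : z ∈ Set.Icc (0:ℝ) (1/5)) : 76/100 * z ≤ AA z ∧ AA z ≤ 124/100 * z := by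
  have hd : ∀ r ∈ Set.Icc (0:ℝ) (1/5), HasDerivWithinAt (fun r => AA r - r) (AA1 r - 1) (Set.Icc (0:ℝ) (1/5)) r :=
    fun r hr => ((AA_deriv (small hr)).sub (hasDerivAt_id r)).hasDerivWithinAt
  have := Convex.norm_image_sub_le_of_norm_hasDerivWithin_le hd (fun r hr => by
    rw [Real.norm_eq_abs]; exact AA1_bound hr.1 hr.2) (convex_Icc _ _) (⟨le_rfl, by norm_num⟩ : (0:ℝ) ∈ Set.Icc (0:ℝ) (1/5)) h
  rw [Real.norm_eq_abs, Real.norm_eq_abs, AA_zero, sub_zero, sub_zero, sub_zero, abs_of_nonneg h.1, abs_le] at this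
  constructor <;> linarith [this.1, this.2]

lemma AA1_bounds {z : ℝ} (h : z ∈ Set.Icc (0:ℝ) (1/5)) : 76/100 ≤ AA1 z ∧ AA1 z ≤ 124/100 := by
  have := abs_le.1 (AA1_bound h.1 h.2)
  constructor <;> linarith [this.1, this.2]

lemma sx_cont : ContinuousOn sx (Set.Icc (0:ℝ) (1/5)) := fun z hz =>
  ((AA_deriv (small hz)).continuousAt.const_add (-1)).continuousWithinAt
lemma sy_cont : ContinuousOn sy (Set.Icc (0:ℝ) (1/5)) := fun z hz =>
  (((continuousAt_const).mul continuousAt_id).mul (AA1_deriv (small hz)).continuousAt).continuousWithinAt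

lemma sx_mono : MonotoneOn sx (Set.Icc (0:ℝ) (1/5)) := by
  refine monotoneOn_of_deriv_nonneg (convex_Icc _ _) sx_cont
    (fun s hs => ((AA_deriv (small (interior_subset hs))).const_add (-1)).differentiableAt.differentiableWithinAt) fun s hs => ?_
  have h : HasDerivAt sx (AA1 s) s := (AA_deriv (small (interior_subset hs))).const_add (-1)
  rw [h.deriv]
  linarith [(AA1_bounds (interior_subset hs)).1]

lemma sy_mono : MonotoneOn sy (Set.Icc (0:ℝ) (1/5)) := by
  have hd : ∀ s ∈ Set.Icc (0:ℝ) (1/5), HasDerivAt sy (16 * AA1 s + 16 * s * AA2 s) s := by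
    intro s hs
    have := ((hasDerivAt_id s).const_mul 16).mul (AA1_deriv (small hs))
    refine HasDerivAt.congr_deriv this ?_
    simp
  refine monotoneOn_of_deriv_nonneg (convex_Icc _ _) sy_cont
    (fun s hs => (hd s (interior_subset hs)).differentiableAt.differentiableWithinAt) fun s hs => ?_
  rw [(hd s (interior_subset hs)).deriv]
  rw [interior_Icc] at hs
  have hs' : s ∈ Set.Icc (0:ℝ) (1/5) := ⟨hs.1.le, hs.2.le⟩
  have ode := AA_ode (small hs')
  have b := AA_bounds hs'
  have b1 := AA1_bounds hs'
  have hA0 : 0 ≤ AA s := by linarith [hs'.1]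
  have hA1 : AA s ≤ 1 := by linarith [hs'.2]
  have e : s * (16 * AA1 s + 16 * s * AA2 s) = 8 * s * AA1 s + 4 * (AA s * ((1 - AA s) * (2 - AA s))) := by
    linear_combination 4 * ode
  have : 0 ≤ s * (16 * AA1 s + 16 * s * AA2 s) := by
    rw [e]
    have := mul_nonneg hA0 (mul_nonneg (sub_nonneg.2 hA1) (by linarith : 0 ≤ 2 - AA s))
    have := mul_nonneg hs'.1 (by linarith : 0 ≤ AA1 s)
    linarith
  exact nonneg_of_mul_nonneg_right this hs.1

lemma sxy {z : ℝ} (h : z ∈ Set.Icc (0:ℝ) (1/5)) : sx z + 1 ≤ sy z / 9 ∧ 0 ≤ sx z + 1 ∧ 0 ≤ sy z ∧ sy z ≤ 4 := by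
  have b := AA_bounds h
  have b1 := AA1_bounds h
  have h0 := h.1
  have h1 := h.2
  have c1 := mul_le_mul_of_nonneg_left b1.1 h0
  have c2 := mul_le_mul_of_nonneg_left b1.2 h0
  simp only [sx, sy]
  refine ⟨?_, ?_, ?_, ?_⟩ <;> nlinarith

lemma sy_pos {z : ℝ} (h : z ∈ Set.Icc (0:ℝ) (1/5)) (hz : 0 < z) : 0 < sy z := by
  have b1 := AA1_bounds h
  have : 0 < AA1 z := by linarith
  rw [sy]; positivity

/-- the shooting result: matching parameters -/
lemma shoot {q : ℝ → ℝ} (hq : Wt q) (u v : ℝ → ℝ → ℝ) (hS : ∀ z, Sol q (sx z) (sy z) (u z) (v z)) :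
    (∃ z ∈ Set.Ioc (0:ℝ) (1/5), u z 0 = 0) ∧
    ∃ x ∈ Set.Icc (1/2:ℝ) (9/10), ∃ z ∈ Set.Ioc (0:ℝ) (1/5), ∃ z' ∈ Set.Ioc (0:ℝ) (1/5),
      u z 0 = x ∧ u z' 0 = -x ∧ v z 0 = v z' 0 := by
  have key : ∀ z ∈ Set.Icc (0:ℝ) (1/5), ∀ z' ∈ Set.Icc (0:ℝ) (1/5), |v z 0 - v z' 0| ≤ 20 * |u z 0 - u z' 0| := by
    intro z hz z' hz'
    rcases le_total z' z with h | h
    · have := (hS z).diff hq (hS z') (sx_mono hz' hz h) (sy_mono hz' hz h)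
      exact this.2.2.trans (mul_le_mul_of_nonneg_left (le_abs_self _) (by norm_num))
    · have := (hS z').diff hq (hS z) (sx_mono hz hz' h) (sy_mono hz hz' h)
      rw [abs_sub_comm, abs_sub_comm (u z 0)]
      exact this.2.2.trans (mul_le_mul_of_nonneg_left (le_abs_self _) (by norm_num))
  have Xc : ContinuousOn (fun z => u z 0) (Set.Icc (0:ℝ) (1/5)) := by
    have kx : ∀ z ∈ Set.Icc (0:ℝ) (1/5), ∀ z' ∈ Set.Icc (0:ℝ) (1/5), |u z' 0 - u z 0| ≤ 2 * (|sx z' - sx z| + 7/8 * |sy z' - sy z|) := by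
      intro z hz z' hz'
      rcases le_total z' z with h | h
      · have := (hS z).diff hq (hS z') (sx_mono hz' hz h) (sy_mono hz' hz h)
        have m1 := sx_mono hz' hz h
        have m2 := sy_mono hz' hz h
        rw [abs_sub_comm, abs_sub_comm (sx z'), abs_sub_comm (sy z'), abs_of_nonneg (sub_nonneg.2 m1), abs_of_nonneg (sub_nonneg.2 m2), abs_of_nonneg (by linarith [this.1])]
        exact this.2.1
      · have := (hS z').diff hq (hS z) (sx_mono hz hz' h) (sy_mono hz hz' h)
        have m1 := sx_mono hz hz' h
        have m2 := sy_mono hz hz' h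
        rw [abs_of_nonneg (sub_nonneg.2 m1), abs_of_nonneg (sub_nonneg.2 m2), abs_of_nonneg (by linarith [this.1])]
        exact this.2.1
    intro z hz
    rw [ContinuousWithinAt, tendsto_iff_dist_tendsto_zero]
    have c : Filter.Tendsto (fun z' => 2 * (|sx z' - sx z| + 7/8 * |sy z' - sy z|)) (nhdsWithin z (Set.Icc (0:ℝ) (1/5))) (nhds 0) := by
      have c1 : ContinuousWithinAt (fun z' => 2 * (|sx z' - sx z| + 7/8 * |sy z' - sy z|)) (Set.Icc (0:ℝ) (1/5)) z := by
        have a1 := sx_cont z hz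
        have a2 := sy_cont z hz
        fun_prop
      have := c1.tendsto
      simpa using this
    refine squeeze_zero' (Filter.Eventually.of_forall fun _ => dist_nonneg) ?_ c
    filter_upwards [self_mem_nhdsWithin] with z' hz'
    rw [Real.dist_eq]; exact kx z hz z' hz'
  have h0m : (0:ℝ) ∈ Set.Icc (0:ℝ) (1/5) := ⟨le_rfl, by norm_num⟩
  have h1m : (1/5:ℝ) ∈ Set.Icc (0:ℝ) (1/5) := ⟨by norm_num, le_rfl⟩
  have X0 : u 0 0 ≤ -99/100 := by
    have := (abs_le.1 ((hS 0).lin hq zero_mem)).2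
    simp only [sx, sy, AA_zero] at this
    linarith
  have X1 : 1 ≤ u (1/5) 0 := by
    have := (abs_le.1 ((hS (1/5)).lin hq zero_mem)).1
    have b := (AA_bounds h1m).1
    have b1 := (AA1_bounds h1m).1
    simp only [sx, sy] at this
    linarith
  have surj : ∀ x ∈ Set.Icc (-9/10:ℝ) (9/10), ∃ z ∈ Set.Ioc (0:ℝ) (1/5), u z 0 = x := by
    intro x hx
    obtain ⟨z, hz, e⟩ := intermediate_value_Icc (by norm_num) Xc (⟨by linarith [hx.1], by linarith [hx.2]⟩ : x ∈ Set.Icc (u 0 0) (u (1/5) 0))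
    refine ⟨z, ⟨lt_of_le_of_ne hz.1 ?_, hz.2⟩, e⟩
    rintro rfl
    simp only at e
    linarith [hx.1]
  refine ⟨surj 0 (by norm_num), ?_⟩
  choose! ζ hζ hζe using surj
  have hζ' : ∀ x ∈ Set.Icc (-9/10:ℝ) (9/10), ζ x ∈ Set.Icc (0:ℝ) (1/5) := fun x hx => ⟨(hζ x hx).1.le, (hζ x hx).2⟩
  have nm : ∀ x ∈ Set.Icc (1/2:ℝ) (9/10), x ∈ Set.Icc (-9/10:ℝ) (9/10) ∧ -x ∈ Set.Icc (-9/10:ℝ) (9/10) := by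
    intro x hx
    refine ⟨⟨by linarith [hx.1], hx.2⟩, ⟨by linarith [hx.2], by linarith [hx.1]⟩⟩
  have Yc : ContinuousOn (fun x => v (ζ x) 0) (Set.Icc (-9/10:ℝ) (9/10)) := by
    have : LipschitzOnWith 20 (fun x => v (ζ x) 0) (Set.Icc (-9/10:ℝ) (9/10)) := by
      refine LipschitzOnWith.of_dist_le_mul fun x hx x' hx' => ?_
      rw [Real.dist_eq, Real.dist_eq]
      have := key _ (hζ' x hx) _ (hζ' x' hx')
      rw [hζe x hx, hζe x' hx'] at this
      exact this
    exact this.continuousOn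
  have Hc : ContinuousOn (fun x => v (ζ (-x)) 0 - v (ζ x) 0) (Set.Icc (1/2:ℝ) (9/10)) := by
    refine ContinuousOn.sub ?_ (Yc.mono fun x hx => (nm x hx).1)
    exact Yc.comp continuous_neg.continuousOn fun x hx => (nm x hx).2
  -- end estimates
  have est : ∀ x ∈ Set.Icc (-9/10:ℝ) (9/10), |v (ζ x) 0 - sy (ζ x) - (∫ s in (-7/8:ℝ)..0, q s) * (x^3-x)| ≤ 1/100 ∧
      sy (ζ x) * (7/8) ≤ x + 1 + 1/1000 ∧ x + 1 - 1/1000 ≤ sy (ζ x) * (7/8+1/9) := by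
    intro x hx
    have b := sxy (hζ' x hx)
    have e := (hS (ζ x)).end_est hq b.2.2.1 b.2.2.2
    have l := abs_le.1 ((hS (ζ x)).lin hq zero_mem)
    rw [hζe x hx] at e l
    rw [F_eq (by linarith [hx.1]) (by linarith [hx.2])] at e
    refine ⟨e, ?_, ?_⟩
    · linarith [l.1]
    · linarith [l.2]
  have lo := hq.lo
  have up := hq.up
  set P := ∫ s in (-7/8:ℝ)..0, q s
  have Hhalf : 0 ≤ v (ζ (-(1/2))) 0 - v (ζ (1/2)) 0 := by
    obtain ⟨a1, a2, a3⟩ := est (1/2) (by norm_num)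
    obtain ⟨b1, b2, b3⟩ := est (-(1/2)) (by norm_num)
    rw [abs_le] at a1 b1
    norm_num at a1 b1
    linarith [a1.1, a1.2, b1.1, b1.2]
  have Hnine : v (ζ (-(9/10))) 0 - v (ζ (9/10)) 0 ≤ 0 := by
    obtain ⟨a1, a2, a3⟩ := est (9/10) (by norm_num)
    obtain ⟨b1, b2, b3⟩ := est (-(9/10)) (by norm_num)
    rw [abs_le] at a1 b1
    norm_num at a1 b1
    linarith [a1.1, a1.2, b1.1, b1.2]
  obtain ⟨x, hx, e⟩ := intermediate_value_Icc' (by norm_num) Hc (⟨Hnine, Hhalf⟩ : (0:ℝ) ∈ Set.Icc _ _)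
  simp only at e
  obtain ⟨n1, n2⟩ := nm x hx
  exact ⟨x, hx, ζ x, hζ x n1, ζ (-x), hζ _ n2, hζe x n1, hζe _ n2, by linarith⟩
end XC
namespace XC
open MeasureTheory

noncomputable def G (z r : ℝ) : ℝ := -1 + AA (64 * z * (r+1)^2)
noncomputable def G1 (z r : ℝ) : ℝ := 128 * z * (r+1) * AA1 (64 * z * (r+1)^2)
noncomputable def G2 (z r : ℝ) : ℝ := 128 * z * AA1 (64 * z * (r+1)^2) + 16384 * z^2 * (r+1)^2 * AA2 (64 * z * (r+1)^2)

lemma inner_deriv (z r : ℝ) : HasDerivAt (fun r : ℝ => 64 * z * (r+1)^2) (128 * z * (r+1)) r := by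
  have := ((((hasDerivAt_id r).add_const 1).pow 2).const_mul (64*z))
  refine HasDerivAt.congr_deriv this ?_
  simp; ring

lemma G_deriv {z r : ℝ} (h : |64 * z * (r+1)^2| < 2) : HasDerivAt (G z) (G1 z r) r := by
  have := ((AA_deriv h).comp r (inner_deriv z r)).const_add (-1)
  refine HasDerivAt.congr_deriv this ?_
  rw [G1]; ring

lemma G1_deriv {z r : ℝ} (h : |64 * z * (r+1)^2| < 2) : HasDerivAt (G1 z) (G2 z r) r := by
  have h1 : HasDerivAt (fun r : ℝ => 128 * z * (r+1)) (128 * z) r := by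
    simpa using ((hasDerivAt_id r).add_const 1).const_mul (128*z)
  have := h1.mul ((AA1_deriv h).comp r (inner_deriv z r))
  refine HasDerivAt.congr_deriv this ?_
  simp only [G2, Function.comp]; ring

lemma G_ode {z r : ℝ} (h : |64 * z * (r+1)^2| < 2) (hr : -1 < r) :
    G2 z r = ((r+1)^2)⁻¹ * (G z r^3 - G z r) := by
  have ode := AA_ode h
  have : (0:ℝ) < r + 1 := by linarith
  have e : G z r^3 - G z r = (r+1)^2 * G2 z r := by
    simp only [G, G2]
    linear_combination -ode
  rw [e]; field_simp

lemma small2 {z r : ℝ} (hz : z ∈ Set.Ioc (0:ℝ) (1/5)) (h : |r+1| ≤ 1/8) : |64 * z * (r+1)^2| < 2 := by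
  have h1 : (r+1)^2 ≤ (1/8)^2 := sq_le_sq' (by linarith [(abs_le.1 h).1]) (abs_le.1 h).2
  have h0 := hz.1
  rw [abs_of_nonneg (by positivity)]
  nlinarith [hz.2, sq_nonneg (r+1)]

lemma glue {f g f' g' : ℝ → ℝ} {c r : ℝ} (hf : r ≤ c → HasDerivAt f (f' r) r)
    (hg : c ≤ r → HasDerivAt g (g' r) r) (e : f c = g c) (e' : f' c = g' c) :
    HasDerivAt (fun r => if r ≤ c then f r else g r) (if r ≤ c then f' r else g' r) r := by
  rcases lt_trichotomy r c with h | h | h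
  · rw [if_pos h.le]
    refine (hf h.le).congr_of_eventuallyEq ?_
    filter_upwards [Iio_mem_nhds h] with s hs
    rw [if_pos (le_of_lt hs)]
  · subst h
    rw [if_pos le_rfl]
    have h1 : HasDerivWithinAt (fun s => if s ≤ r then f s else g s) (f' r) (Set.Iic r) r :=
      (hf le_rfl).hasDerivWithinAt.congr (fun s hs => if_pos hs) (if_pos le_rfl)
    have h2 : HasDerivWithinAt (fun s => if s ≤ r then f s else g s) (f' r) (Set.Ici r) r := by
      rw [e']
      refine (hg le_rfl).hasDerivWithinAt.congr (fun s hs => ?_) (by rw [if_pos le_rfl, e])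
      rcases (Set.mem_Ici.1 hs).eq_or_lt with h | h
      · subst h; rw [if_pos le_rfl, e]
      · rw [if_neg (not_le.2 h)]
    have := h1.union h2
    rwa [Set.Iic_union_Ici, hasDerivWithinAt_univ] at this
  · rw [if_neg (not_le.2 h)]
    refine (hg h.le).congr_of_eventuallyEq ?_
    filter_upwards [Ioi_mem_nhds h] with s hs
    rw [if_neg (not_le.2 hs)]

/-- everything needed about a solution on the left half -/
structure Half (p : ℝ → ℝ) (z : ℝ) (U V : ℝ → ℝ) : Prop where
  zp : z ∈ Set.Ioc (0:ℝ) (1/5)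
  dU : ∀ r ∈ Set.Ioc (-1:ℝ) 0, HasDerivAt U (V r) r
  dV : ∀ r ∈ Set.Ioc (-1:ℝ) 0, HasDerivAt V (p r * (U r ^ 3 - U r)) r
  pos : ∀ r ∈ Set.Ioc (-1:ℝ) 0, 0 < V r
  ser : ∀ r, r ≤ -7/8 → U r = G z r

lemma half_exists {p q : ℝ → ℝ} (hq : Wt q) (hpq : ∀ r ∈ Set.Icc (-7/8:ℝ) 0, q r = p r)
    (hp : ∀ r, r ≤ -7/8 → p r = ((r+1)^2)⁻¹) {z : ℝ} (hz : z ∈ Set.Ioc (0:ℝ) (1/5)) {u v : ℝ → ℝ}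
    (hS : Sol q (sx z) (sy z) u v) (h1 : u 0 ≤ 1) :
    ∃ U V : ℝ → ℝ, Half p z U V ∧ U 0 = u 0 ∧ V 0 = v 0 := by
  have hz' : z ∈ Set.Icc (0:ℝ) (1/5) := ⟨hz.1.le, hz.2⟩
  have b := sxy hz'
  have y0 := sy_pos hz' hz.1
  have ec : G z (-7/8) = u (-7/8) := by
    rw [hS.ux, G, sx]; norm_num; congr 1; ring
  have ec' : G1 z (-7/8) = v (-7/8) := by
    rw [hS.vy, G1, sy]; norm_num
    rw [show 64 * z * (1/64) = z by ring]; ring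
  have hsm : ∀ r, -1 < r → r ≤ -7/8 → |64 * z * (r+1)^2| < 2 := fun r h1 h2 =>
    small2 hz (by rw [abs_le]; constructor <;> linarith)
  have odeu : ∀ r ∈ Set.Icc (-7/8:ℝ) 0, q r * F (u r) = p r * (u r^3 - u r) := by
    intro r hr
    have m := hS.mem hq y0 b.1 hr
    rw [hpq r hr, F_eq (by linarith [m.1, b.2.1]) (by linarith [m.2])]
  refine ⟨fun r => if r ≤ -7/8 then G z r else u r, fun r => if r ≤ -7/8 then G1 z r else v r,
    ⟨hz, ?_, ?_, ?_, fun r hr => if_pos hr⟩, if_neg (by norm_num), if_neg (by norm_num)⟩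
  · intro r hr
    exact glue (fun h => G_deriv (hsm r hr.1 h)) (fun h => hS.du r) ec ec'
  · intro r hr
    have := glue (f := G1 z) (g := v) (c := -7/8) (r := r) (f' := G2 z) (g' := fun r => q r * F (u r))
      (fun h => G1_deriv (hsm r hr.1 h)) (fun h => hS.dv r ⟨h, hr.2⟩) ec' (by
        rw [odeu _ ⟨le_rfl, by norm_num⟩, ← ec, hp _ le_rfl, G_ode (hsm _ (by norm_num) le_rfl) (by norm_num)])
    refine HasDerivAt.congr_deriv this ?_
    beta_reduce
    split_ifs with h
    · rw [G_ode (hsm r hr.1 h) hr.1, hp r h]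
    · exact odeu r ⟨(not_le.1 h).le, hr.2⟩
  · intro r hr
    beta_reduce
    split_ifs with h
    · have hr0 : 0 < r + 1 := by linarith [hr.1]
      have hw : 64 * z * (r+1)^2 ∈ Set.Icc (0:ℝ) (1/5) := by
        have := hz.1
        refine ⟨by positivity, ?_⟩
        have : (r+1)^2 ≤ (1/8)^2 := sq_le_sq' (by linarith) (by linarith)
        nlinarith [hz.2]
      have := (AA1_bounds hw).1
      have h2 : 0 < AA1 (64 * z * (r+1)^2) := by linarith
      have := hz.1
      rw [G1]; positivity
    · exact hS.vpos hq y0 b.1 ⟨(not_le.1 h).le, hr.2⟩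

lemma bootstrap {p m n : ℝ → ℝ} (hp : ContDiffOn ℝ (⊤ : ℕ∞) p (Set.Ioo (-1) 1))
    (hm : ∀ r ∈ Set.Ioo (-1:ℝ) 1, HasDerivAt m (n r) r)
    (hn : ∀ r ∈ Set.Ioo (-1:ℝ) 1, HasDerivAt n (p r * (m r^3 - m r)) r) :
    ContDiffOn ℝ (⊤ : ℕ∞) m (Set.Ioo (-1) 1) := by
  have key : ∀ k : ℕ, ContDiffOn ℝ k m (Set.Ioo (-1) 1) ∧ ContDiffOn ℝ k n (Set.Ioo (-1) 1) := by
    intro k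
    induction k with
    | zero =>
      simp only [Nat.cast_zero, contDiffOn_zero]
      exact ⟨fun r hr => (hm r hr).continuousAt.continuousWithinAt, fun r hr => (hn r hr).continuousAt.continuousWithinAt⟩
    | succ k ih =>
      push_cast
      rw [contDiffOn_succ_iff_deriv_of_isOpen isOpen_Ioo, contDiffOn_succ_iff_deriv_of_isOpen isOpen_Ioo]
      refine ⟨⟨fun r hr => (hm r hr).differentiableAt.differentiableWithinAt, by simp, ?_⟩,
        ⟨fun r hr => (hn r hr).differentiableAt.differentiableWithinAt, by simp, ?_⟩⟩
      · exact ih.2.congr fun r hr => (hm r hr).deriv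
      · have : ContDiffOn ℝ k (fun r => p r * (m r^3 - m r)) (Set.Ioo (-1) 1) :=
          (contDiffOn_infty.1 hp k).mul ((ih.1.pow 3).sub ih.1)
        exact this.congr fun r hr => (hn r hr).deriv
  exact contDiffOn_infty.2 fun k => (key k).1

/-- The requirements on one solution. -/
def Good (p l : ℝ → ℝ) : Prop :=
  ContDiffOn ℝ (⊤ : ℕ∞) l (Set.Ioo (-3 : ℝ) 3) ∧
          (∀ t ∈ Set.Ioo (-2 : ℝ) 2, l (-1 - t) = l (-1 + t)) ∧
          (∀ t ∈ Set.Ioo (-2 : ℝ) 2, l (1 + t) = l (1 - t)) ∧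
          (∀ r ∈ Set.Ioo (-1 : ℝ) 1, deriv (deriv l) r = (l r ^ 3 - l r) / (p r)⁻¹) ∧
          l (-1) = -1 ∧ l 1 = 1 ∧
          (∀ r ∈ Set.Ioo (-1 : ℝ) 1, 0 < deriv l r) ∧
          0 < deriv (deriv l) (-1) ∧ deriv (deriv l) 1 < 0

lemma G_contDiffAt (z : ℝ) : ContDiffAt ℝ (⊤ : ℕ∞) (G z) (-1) := by
  have h1 : ContDiffAt ℝ (⊤ : ℕ∞) AA (64 * z * ((-1:ℝ)+1)^2) :=
    AA_contDiffOn.contDiffAt (Ioo_mem_nhds (by norm_num) (by norm_num))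
  have h2 : ContDiffAt ℝ (⊤ : ℕ∞) (fun r : ℝ => 64 * z * (r+1)^2) (-1) := by fun_prop
  have h3 : ContDiffAt ℝ (⊤ : ℕ∞) (AA ∘ fun r : ℝ => 64 * z * (r+1)^2) (-1) :=
    ContDiffAt.comp (-1:ℝ) h1 h2
  exact contDiffAt_const.add h3

lemma G_deriv2 {z : ℝ} (hz : z ∈ Set.Ioc (0:ℝ) (1/5)) : deriv (deriv (G z)) (-1) = 128 * z := by
  have h : deriv (G z) =ᶠ[nhds (-1)] G1 z := by
    filter_upwards [Ioo_mem_nhds (show (-9/8:ℝ) < -1 by norm_num) (show (-1:ℝ) < -7/8 by norm_num)] with r hr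
    exact (G_deriv (small2 hz (by rw [abs_le]; constructor <;> linarith [hr.1, hr.2]))).deriv
  rw [h.deriv_eq, (G1_deriv (small2 hz (by norm_num))).deriv, G2]
  norm_num [AA1_zero]

lemma build {p : ℝ → ℝ} (hp : ContDiffOn ℝ (⊤ : ℕ∞) p (Set.Ioo (-1) 1)) (hev : ∀ r, p (-r) = p r)
    {z z' : ℝ} {U V U' V' : ℝ → ℝ} (h : Half p z U V) (h' : Half p z' U' V')
    (e : U 0 = - U' 0) (e' : V 0 = V' 0) :
    ∃ l, Good p l ∧ l 0 = U 0 ∧ (U = U' → ∀ r ∈ Set.Icc (-1:ℝ) 1, l (-r) = - l r) := by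
  set m : ℝ → ℝ := fun r => if r ≤ 0 then U r else - U' (-r) with hm
  set n : ℝ → ℝ := fun r => if r ≤ 0 then V r else V' (-r) with hn
  have dm : ∀ r ∈ Set.Ioo (-1:ℝ) 1, HasDerivAt m (n r) r := by
    intro r hr
    refine glue (f := U) (g := fun r => - U' (-r)) (f' := V) (g' := fun r => V' (-r)) (fun h0 => h.dU r ⟨hr.1, h0⟩) (fun h0 => ?_) (by simpa using e) (by simpa using e')
    have := ((h'.dU (-r) ⟨by linarith [hr.2], by linarith⟩).comp r (hasDerivAt_neg r)).neg
    refine HasDerivAt.congr_deriv this ?_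
    ring
  have dn : ∀ r ∈ Set.Ioo (-1:ℝ) 1, HasDerivAt n (p r * (m r^3 - m r)) r := by
    intro r hr
    have := glue (r := r) (c := 0) (f := V) (g := fun r => V' (-r)) (f' := fun r => p r * (U r^3 - U r))
      (g' := fun r => p r * ((- U' (-r))^3 - (- U' (-r)))) (fun h0 => h.dV r ⟨hr.1, h0⟩) (fun h0 => by
        have := ((h'.dV (-r) ⟨by linarith [hr.2], by linarith⟩).comp r (hasDerivAt_neg r))
        refine HasDerivAt.congr_deriv this ?_
        rw [hev]; ring) (by simpa using e') (by simp [e])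
    refine HasDerivAt.congr_deriv this ?_
    simp only [hm]
    split_ifs <;> rfl
  have npos : ∀ r ∈ Set.Ioo (-1:ℝ) 1, 0 < n r := by
    intro r hr
    simp only [hn]
    split_ifs with h0
    · exact h.pos r ⟨hr.1, h0⟩
    · exact h'.pos _ ⟨by linarith [hr.2], by linarith [not_le.1 h0]⟩
  have ms := bootstrap hp dm dn
  have msA : ∀ r ∈ Set.Ioo (-1:ℝ) 1, ContDiffAt ℝ (⊤ : ℕ∞) m r := fun r hr => ms.contDiffAt (isOpen_Ioo.mem_nhds hr)
  have mL : ∀ r, r ≤ -7/8 → m r = G z r := fun r hr => by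
    simp only [hm]; rw [if_pos (by linarith), h.ser r hr]
  have mR : ∀ r, 7/8 ≤ r → m r = - G z' (-r) := fun r hr => by
    simp only [hm]; rw [if_neg (by linarith), h'.ser (-r) (by linarith)]
  set l : ℝ → ℝ := fun r => if r ≤ -1 then m (-2 - r) else if r ≤ 1 then m r else m (2 - r) with hl
  have lmid : ∀ r ∈ Set.Icc (-1:ℝ) 1, l r = m r := by
    intro r hr
    simp only [hl]
    split_ifs with h1 h2
    · have : r = -1 := le_antisymm h1 hr.1
      subst this; norm_num
    · rfl
    · exact absurd hr.2 h2
  have lleft : ∀ r, r ≤ -1 → l r = m (-2 - r) := fun r hr => if_pos hr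
  have lright : ∀ r, 1 ≤ r → l r = m (2 - r) := fun r hr => by
    rcases hr.eq_or_lt with h1 | h1
    · subst h1; rw [lmid _ (by norm_num)]; norm_num
    · simp only [hl]; rw [if_neg (by linarith), if_neg (by linarith)]
  have nearL : l =ᶠ[nhds (-1)] G z := by
    filter_upwards [Ioo_mem_nhds (show (-9/8:ℝ) < -1 by norm_num) (show (-1:ℝ) < -7/8 by norm_num)] with r hr
    rcases le_total r (-1) with h1 | h1
    · rw [lleft r h1, mL _ (by linarith [hr.1]), G, G]; congr 2; ring
    · rw [lmid r ⟨h1, by linarith [hr.2]⟩, mL _ hr.2.le]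
  have nearR : l =ᶠ[nhds 1] fun r => - G z' (-r) := by
    filter_upwards [Ioo_mem_nhds (show (7/8:ℝ) < 1 by norm_num) (show (1:ℝ) < 9/8 by norm_num)] with r hr
    rcases le_total r 1 with h1 | h1
    · rw [lmid r ⟨by linarith [hr.1], h1⟩, mR _ hr.1.le]
    · rw [lright r h1, mR _ (by linarith [hr.2]), G, G]; congr 3; ring
  have lnear : ∀ r ∈ Set.Ioo (-1:ℝ) 1, l =ᶠ[nhds r] m := by
    intro r hr
    filter_upwards [isOpen_Ioo.mem_nhds hr] with s hs
    exact lmid s ⟨hs.1.le, hs.2.le⟩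
  have dl : ∀ r ∈ Set.Ioo (-1:ℝ) 1, deriv l r = n r := fun r hr => by
    rw [(lnear r hr).deriv_eq, (dm r hr).deriv]
  have ddl : ∀ r ∈ Set.Ioo (-1:ℝ) 1, deriv (deriv l) r = p r * (m r^3 - m r) := fun r hr => by
    have : deriv l =ᶠ[nhds r] n := by
      filter_upwards [isOpen_Ioo.mem_nhds hr] with s hs
      exact dl s hs
    rw [this.deriv_eq, (dn r hr).deriv]
  refine ⟨l, ⟨?_, ?_, ?_, ?_, ?_, ?_, ?_, ?_, ?_⟩, ?_, ?_⟩
  · intro r hr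
    refine ContDiffAt.contDiffWithinAt ?_
    rcases lt_trichotomy r (-1) with h1 | h1 | h1
    · have c : ContDiffAt ℝ (⊤ : ℕ∞) (fun r => m (-2 - r)) r :=
        (msA (-2-r) ⟨by linarith, by linarith [hr.1]⟩).comp r (by fun_prop)
      refine c.congr_of_eventuallyEq ?_
      filter_upwards [Iio_mem_nhds h1] with s hs
      exact lleft s (le_of_lt hs)
    · subst h1
      exact (G_contDiffAt z).congr_of_eventuallyEq nearL
    · rcases lt_trichotomy r 1 with h2 | h2 | h2
      · exact (msA r ⟨h1, h2⟩).congr_of_eventuallyEq (lnear r ⟨h1, h2⟩)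
      · subst h2
        have c : ContDiffAt ℝ (⊤ : ℕ∞) (fun r => - G z' (-r)) 1 :=
          ((G_contDiffAt z').comp (1:ℝ) (contDiff_neg.contDiffAt)).neg
        exact c.congr_of_eventuallyEq nearR
      · have c : ContDiffAt ℝ (⊤ : ℕ∞) (fun r => m (2 - r)) r :=
          (msA (2-r) ⟨by linarith [hr.2], by linarith⟩).comp r (by fun_prop)
        refine c.congr_of_eventuallyEq ?_
        filter_upwards [Ioi_mem_nhds h2] with s hs
        exact lright s (le_of_lt hs)
  · intro t ht
    rcases le_total 0 t with h0 | h0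
    · rw [lleft _ (by linarith), lmid (-1+t) ⟨by linarith, by linarith [ht.2]⟩]; congr 1; ring
    · rw [lleft (-1+t) (by linarith), lmid (-1-t) ⟨by linarith, by linarith [ht.1]⟩]; congr 1; ring
  · intro t ht
    rcases le_total 0 t with h0 | h0
    · rw [lright _ (by linarith), lmid (1-t) ⟨by linarith [ht.2], by linarith⟩]; congr 1; ring
    · rw [lright (1-t) (by linarith), lmid (1+t) ⟨by linarith [ht.1], by linarith⟩]; congr 1; ring
  · intro r hr
    rw [ddl r hr, lmid r ⟨hr.1.le, hr.2.le⟩, div_inv_eq_mul, mul_comm]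
  · rw [lmid _ (by norm_num), mL _ (by norm_num), G]; norm_num [AA_zero]
  · rw [lmid _ (by norm_num), mR _ (by norm_num), G]; norm_num [AA_zero]
  · intro r hr; rw [dl r hr]; exact npos r hr
  · rw [nearL.deriv.deriv_eq, G_deriv2 h.zp]; linarith [h.zp.1]
  · have e1 : deriv (fun r => - G z' (-r)) = fun r => deriv (G z') (-r) := by
      funext r
      rw [deriv.fun_neg, deriv_comp_neg, neg_neg]
    rw [nearR.deriv.deriv_eq, e1, deriv_comp_neg, G_deriv2 h'.zp]; linarith [h'.zp.1]
  · rw [lmid _ (by norm_num)]; simp [hm]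
  · intro hU r hr
    subst hU
    rw [lmid _ hr, lmid _ ⟨by linarith [hr.2], by linarith [hr.1]⟩]
    simp only [hm]
    rcases lt_trichotomy r 0 with h1 | h1 | h1
    · rw [if_neg (by linarith), if_pos h1.le, neg_neg]
    · subst h1; simp; linarith
    · rw [if_pos (by linarith), if_neg (by linarith), neg_neg]

end XC


/-- non-uniqueness for the `SO(3)` problem: the ODE content of the
counterexample to Hamilton's uniqueness conjecture.  There exist a smooth positive
function `σ` on `[-1,1]`, even about `0` and equal to `(r+1)²` on `[-1,-7/8]`, and
three pairwise distinct functions `l₋, l₊, l₀` on `[-1,1]` — each the restriction of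
a smooth function on `(-3,3)` even about `-1` and about `1` — solving
`l'' = (l³ - l)/σ` on `(-1,1)` with `l(-1) = -1`, `l(1) = 1`, `l' > 0` on `(-1,1)`,
`l''(-1) > 0`, `l''(1) < 0`, such that `l₀` is odd about `0` while neither `l₋` nor
`l₊` is. -/
theorem stmt_16 :
    ∃ σ : ℝ → ℝ,
      ContDiffOn ℝ (⊤ : ℕ∞) σ (Set.Icc (-1) 1) ∧
      (∀ r ∈ Set.Ioo (-1 : ℝ) 1, 0 < σ r) ∧
      (∀ r ∈ Set.Icc (-1 : ℝ) 1, σ (-r) = σ r) ∧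
      (∀ r ∈ Set.Icc (-1 : ℝ) (-7 / 8), σ r = (r + 1) ^ 2) ∧
      ∃ lm lp l₀ : ℝ → ℝ,
        (∀ l ∈ ({lm, lp, l₀} : Set (ℝ → ℝ)),
          ContDiffOn ℝ (⊤ : ℕ∞) l (Set.Ioo (-3 : ℝ) 3) ∧
          (∀ t ∈ Set.Ioo (-2 : ℝ) 2, l (-1 - t) = l (-1 + t)) ∧
          (∀ t ∈ Set.Ioo (-2 : ℝ) 2, l (1 + t) = l (1 - t)) ∧
          (∀ r ∈ Set.Ioo (-1 : ℝ) 1, deriv (deriv l) r = (l r ^ 3 - l r) / σ r) ∧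
          l (-1) = -1 ∧ l 1 = 1 ∧
          (∀ r ∈ Set.Ioo (-1 : ℝ) 1, 0 < deriv l r) ∧
          0 < deriv (deriv l) (-1) ∧ deriv (deriv l) 1 < 0) ∧
        (∃ r ∈ Set.Icc (-1 : ℝ) 1, lm r ≠ lp r) ∧
        (∃ r ∈ Set.Icc (-1 : ℝ) 1, lm r ≠ l₀ r) ∧
        (∃ r ∈ Set.Icc (-1 : ℝ) 1, lp r ≠ l₀ r) ∧
        (∀ r ∈ Set.Icc (-1 : ℝ) 1, l₀ (-r) = - l₀ r) ∧
        (∃ r ∈ Set.Icc (-1 : ℝ) 1, lm (-r) ≠ - lm r) ∧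
        (∃ r ∈ Set.Icc (-1 : ℝ) 1, lp (-r) ≠ - lp r) := by
  obtain ⟨p, hps, hpp, hev, hpl, hlo, hup, hmo⟩ := XC.pw_exists
  have hpc : ContinuousOn p (Set.Icc (-7/8) 0) :=
    hps.continuousOn.mono fun r hr => ⟨by linarith [hr.1], by linarith [hr.2]⟩
  have hab : (-7/8:ℝ) ≤ 0 := by norm_num
  obtain ⟨q, hq, hpq⟩ : ∃ q : ℝ → ℝ, XC.Wt q ∧ ∀ r ∈ Set.Icc (-7/8:ℝ) 0, q r = p r := by
    have hpq : ∀ r ∈ Set.Icc (-7/8:ℝ) 0, p (Set.projIcc (-7/8:ℝ) 0 hab r) = p r := by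
      intro r hr
      rw [Set.projIcc_of_mem hab hr]
    have e1 : ∫ s in (-7/8:ℝ)..0, p (Set.projIcc (-7/8:ℝ) 0 hab s) = ∫ s in (-7/8:ℝ)..0, p s := by
      refine intervalIntegral.integral_congr fun s hs => ?_
      rw [Set.uIcc_of_le hab] at hs
      exact hpq s hs
    have e2 : ∫ s in (-7/8:ℝ)..0, -s * p (Set.projIcc (-7/8:ℝ) 0 hab s) = ∫ s in (-7/8:ℝ)..0, -s * p s := by
      refine intervalIntegral.integral_congr fun s hs => ?_
      rw [Set.uIcc_of_le hab] at hs
      beta_reduce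
      rw [hpq s hs]
    refine ⟨fun r => p (Set.projIcc (-7/8:ℝ) 0 hab r), ⟨?_, ?_, ?_, ?_, ?_⟩, hpq⟩
    · exact (continuousOn_iff_continuous_domRestrict.1 hpc).comp continuous_projIcc
    · intro s
      have := (Set.projIcc (-7/8:ℝ) 0 hab s).2
      exact (hpp _ ⟨by linarith [this.1], by linarith [this.2]⟩).le
    · rw [e1]; exact hlo
    · rw [e1]; exact hup
    · rw [e2]; exact hmo
  choose uv huv using fun z => hq.exists (XC.sx z) (XC.sy z)
  obtain ⟨⟨z0, hz0, e0⟩, x, hx, z, hz, z', hz', e1, e2, e3⟩ :=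
    XC.shoot hq (fun z => (uv z).1) (fun z => (uv z).2) huv
  beta_reduce at e0 e1 e2 e3
  obtain ⟨U0, V0, H0, a0, b0⟩ := XC.half_exists hq hpq hpl hz0 (huv z0) (by rw [e0]; norm_num)
  obtain ⟨U, V, H, a, b⟩ := XC.half_exists hq hpq hpl hz (huv z) (by rw [e1]; linarith [hx.2])
  obtain ⟨U', V', H', a', b'⟩ := XC.half_exists hq hpq hpl hz' (huv z') (by rw [e2]; linarith [hx.1])
  rw [e0] at a0
  rw [e1] at a
  rw [e2] at a'
  obtain ⟨l0, G0, v0, o0⟩ := XC.build hps hev H0 H0 (by rw [a0]; norm_num) rfl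
  obtain ⟨lm, Gm, vm, -⟩ := XC.build hps hev H H' (by rw [a, a', neg_neg]) (by rw [b, b', e3])
  obtain ⟨lp, Gp, vp, -⟩ := XC.build hps hev H' H (by rw [a, a']) (by rw [b, b', e3])
  rw [a0] at v0
  rw [a] at vm
  rw [a'] at vp
  have hx0 : 0 < x := by linarith [hx.1]
  have hσl : ∀ r : ℝ, r ≤ -7/8 → (p r)⁻¹ = (r+1)^2 := fun r hr => by rw [hpl r hr, inv_inv]
  have hσr : ∀ r : ℝ, 7/8 ≤ r → (p r)⁻¹ = (-r+1)^2 := fun r hr => by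
    rw [← hev r, hσl (-r) (by linarith)]
  have m0 : (0:ℝ) ∈ Set.Icc (-1:ℝ) 1 := by norm_num
  refine ⟨fun r => (p r)⁻¹, ?_, fun r hr => inv_pos.2 (hpp r hr), fun r _ => congrArg (·⁻¹) (hev r), fun r hr => hσl r hr.2,
    lm, lp, l0, ?_, ⟨0, m0, ?_⟩, ⟨0, m0, ?_⟩, ⟨0, m0, ?_⟩, o0 rfl, ⟨0, m0, ?_⟩, ⟨0, m0, ?_⟩⟩
  · intro r hr
    refine ContDiffAt.contDiffWithinAt ?_
    rcases lt_or_ge r (-7/8) with h1 | h1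
    · have c : ContDiffAt ℝ (⊤ : ℕ∞) (fun r : ℝ => (r+1)^2) r := by fun_prop
      refine c.congr_of_eventuallyEq ?_
      filter_upwards [Iio_mem_nhds h1] with s hs
      exact hσl s (le_of_lt hs)
    · rcases lt_or_ge (7/8) r with h2 | h2
      · have c : ContDiffAt ℝ (⊤ : ℕ∞) (fun r : ℝ => (-r+1)^2) r := by fun_prop
        refine c.congr_of_eventuallyEq ?_
        filter_upwards [Ioi_mem_nhds h2] with s hs
        exact hσr s (le_of_lt hs)
      · have hr' : r ∈ Set.Ioo (-1:ℝ) 1 := ⟨by linarith, by linarith⟩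
        exact (hps.contDiffAt (isOpen_Ioo.mem_nhds hr')).inv (hpp r hr').ne'
  · intro l hl
    rcases hl with rfl | rfl | rfl
    · exact Gm
    · exact Gp
    · exact G0
  · rw [vm, vp]; intro h; linarith
  · rw [vm, v0]; exact hx0.ne'
  · rw [vp, v0]; intro h; linarith
  · rw [neg_zero, vm]; intro h; linarith
  · rw [neg_zero, vp]; intro h; linarith
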